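/- arXiv:1104.4692 — 3 statements merged into one kernel-verified Lean document; each statement's English description precedes it below -/
import Mathlib

section
/- Let d ≥ 2, let X be a finite nonempty subset of Ω(d), and let 𝒮 be a lower set. Then the following are equivalent: (i) X is an 𝒮-code and a complex spherical 𝒮*𝒮-design; (ii) X is an 𝒮-code with |X| = Σ_{(k,l)∈𝒮} m_{k,l} (a tight 𝒮-code); (iii) X is a complex spherical 𝒮*𝒮-design with |X| = Σ_{(k,l)∈𝒮} m_{k,l} (a tight design with respect to 𝒮). -/
open Finset

/-- The Hermitian inner product `x^* y = ∑ i, conj (x i) * y i` on `ℂ^d`. -/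
noncomputable def cInner {d : ℕ} (x y : Fin d → ℂ) : ℂ :=
  ∑ i, (starRingEnd ℂ) (x i) * y i

/-- A lower set in `ℕ × ℕ` with respect to the product order. -/
def IsLowerSet' (T : Finset (ℕ × ℕ)) : Prop :=
  ∀ kl ∈ T, ∀ mn : ℕ × ℕ, mn.1 ≤ kl.1 → mn.2 ≤ kl.2 → mn ∈ T

/-- The average over the unit sphere `Ω(d)` of the monomial
`z ↦ ∏ i, z i ^ a i * conj (z i) ^ b i`. -/
noncomputable def monomialAvg (d : ℕ) (a b : Fin d → ℕ) : ℂ :=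
  if a = b then
    ((Nat.factorial (d - 1) : ℂ) * ∏ i, (Nat.factorial (a i) : ℂ)) /
      (Nat.factorial (d + (∑ i, a i) - 1) : ℂ)
  else 0

/-- `X` is a complex spherical `T`-design: every monomial of bidegree `(k,l) ∈ T`
has the same average over `X` as over the sphere `Ω(d)`. -/
def IsDesign (d : ℕ) (X : Finset (Fin d → ℂ)) (T : Finset (ℕ × ℕ)) : Prop :=
  ∀ kl ∈ T, ∀ a b : Fin d → ℕ, (∑ i, a i) = kl.1 → (∑ i, b i) = kl.2 →
    (∑ z ∈ X, (∏ i, (z i) ^ (a i)) * ∏ i, ((starRingEnd ℂ) (z i)) ^ (b i))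
      = (X.card : ℂ) * monomialAvg d a b

/-- The Jacobi polynomial `g_{k,l}` for the complex sphere in dimension `d`. -/
noncomputable def jacobi (d k l : ℕ) (x : ℂ) : ℂ :=
  (((d + k + l - 1 : ℕ) : ℂ) / (Nat.factorial (d - 1) : ℂ)) *
    ∑ r ∈ Finset.range (min k l + 1),
      (((-1 : ℂ) ^ r * (Nat.factorial (d + k + l - r - 2) : ℂ)) /
          ((Nat.factorial r : ℂ) * (Nat.factorial (k - r) : ℂ) *
            (Nat.factorial (l - r) : ℂ))) *
        x ^ (k - r) * ((starRingEnd ℂ) x) ^ (l - r)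

open scoped Classical in
/-- The inner product set `A(X) = {x^* y : x, y ∈ X, x ≠ y}`. -/
noncomputable def innerSet {d : ℕ} (X : Finset (Fin d → ℂ)) : Finset ℂ :=
  ((X ×ˢ X).filter fun p => p.1 ≠ p.2).image fun p => cInner p.1 p.2

/-- `m_{k,l}`, the dimension of the harmonic space `Harm(k,l)` in dimension `d`. -/
def mdim (d k l : ℕ) : ℕ :=
  (d + k - 1).choose (d - 1) * (d + l - 1).choose (d - 1) -
    (d + k - 2).choose (d - 1) * (d + l - 2).choose (d - 1)

/-- The convolution `U * V = {(k + l', k' + l) : (k,l) ∈ U, (k',l') ∈ V}`. -/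
def convSet (U V : Finset (ℕ × ℕ)) : Finset (ℕ × ℕ) :=
  (U ×ˢ V).image fun p => (p.1.1 + p.2.2, p.2.1 + p.1.2)

/-- `X` is an `S`-code: it has an annihilator polynomial supported on monomials
`x^k * conj x^l` with `(k,l) ∈ S`. -/
def IsCode (d : ℕ) (X : Finset (Fin d → ℂ)) (S : Finset (ℕ × ℕ)) : Prop :=
  ∃ c : ℕ × ℕ → ℝ,
    (∀ α ∈ innerSet X, ∑ kl ∈ S, (c kl : ℂ) * α ^ kl.1 * ((starRingEnd ℂ) α) ^ kl.2 = 0) ∧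
    0 < ∑ kl ∈ S, c kl

namespace TD
open MvPolynomial

/-- Polynomials in `z` (left variables) and `conj z` (right variables). -/
abbrev Poly (d : ℕ) := MvPolynomial (Fin d ⊕ Fin d) ℂ

def w1 (d : ℕ) : Fin d ⊕ Fin d → ℕ := Sum.elim (fun _ => 1) (fun _ => 0)
def w2 (d : ℕ) : Fin d ⊕ Fin d → ℕ := Sum.elim (fun _ => 0) (fun _ => 1)

/-- Bihomogeneous polynomials of bidegree `(k,l)`. -/
noncomputable def Pol (d k l : ℕ) : Submodule ℂ (Poly d) :=
  weightedHomogeneousSubmodule ℂ (w1 d) k ⊓ weightedHomogeneousSubmodule ℂ (w2 d) l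

variable {d k l : ℕ}

lemma mem_Pol {p : Poly d} : p ∈ Pol d k l ↔
    p.IsWeightedHomogeneous (w1 d) k ∧ p.IsWeightedHomogeneous (w2 d) l := Iff.rfl

lemma weight_w1 (s : Fin d ⊕ Fin d →₀ ℕ) : Finsupp.weight (w1 d) s = ∑ i, s (Sum.inl i) := by
  rw [Finsupp.weight_eq_sum]; simp [w1]

lemma weight_w2 (s : Fin d ⊕ Fin d →₀ ℕ) : Finsupp.weight (w2 d) s = ∑ i, s (Sum.inr i) := by
  rw [Finsupp.weight_eq_sum]; simp [w2]

lemma X_mem_l (i : Fin d) : (X (Sum.inl i) : Poly d) ∈ Pol d 1 0 :=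
  ⟨isWeightedHomogeneous_X ℂ (w1 d) (Sum.inl i), isWeightedHomogeneous_X ℂ (w2 d) (Sum.inl i)⟩

lemma X_mem_r (i : Fin d) : (X (Sum.inr i) : Poly d) ∈ Pol d 0 1 :=
  ⟨isWeightedHomogeneous_X ℂ (w1 d) (Sum.inr i), isWeightedHomogeneous_X ℂ (w2 d) (Sum.inr i)⟩

lemma mul_mem {k' l' : ℕ} {p q : Poly d} (hp : p ∈ Pol d k l) (hq : q ∈ Pol d k' l') :
    p * q ∈ Pol d (k + k') (l + l') := ⟨hp.1.mul hq.1, hp.2.mul hq.2⟩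

lemma one_mem : (1 : Poly d) ∈ Pol d 0 0 :=
  ⟨isWeightedHomogeneous_one ℂ _, isWeightedHomogeneous_one ℂ _⟩

lemma pow_mem {p : Poly d} (hp : p ∈ Pol d k l) (n : ℕ) : p ^ n ∈ Pol d (n * k) (n * l) := 
  ⟨hp.1.pow n, hp.2.pow n⟩

lemma pd_l {p : Poly d} (hp : p ∈ Pol d (k + 1) l) (i : Fin d) :
    pderiv (Sum.inl i) p ∈ Pol d k l :=
  ⟨hp.1.pderiv rfl, hp.2.pderiv rfl⟩

lemma pd_r {p : Poly d} (hp : p ∈ Pol d k (l + 1)) (i : Fin d) :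
    pderiv (Sum.inr i) p ∈ Pol d k l :=
  ⟨hp.1.pderiv rfl, hp.2.pderiv rfl⟩

lemma pd_l0 {p : Poly d} (hp : p ∈ Pol d 0 l) (i : Fin d) :
    pderiv (Sum.inl i) p = 0 := by
  ext s
  rw [coeff_pderiv, coeff_zero]
  have : coeff (s + Finsupp.single (Sum.inl i) 1) p = 0 := by
    by_contra h
    have := hp.1 h
    rw [map_add, Finsupp.weight_single] at this
    simp [w1] at this
  simp [this]

lemma pd_r0 {p : Poly d} (hp : p ∈ Pol d k 0) (i : Fin d) :
    pderiv (Sum.inr i) p = 0 := by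
  ext s
  rw [coeff_pderiv, coeff_zero]
  have : coeff (s + Finsupp.single (Sum.inr i) 1) p = 0 := by
    by_contra h
    have := hp.2 h
    rw [map_add, Finsupp.weight_single] at this
    simp [w2] at this
  simp [this]

lemma euler_l {p : Poly d} (hp : p ∈ Pol d k l) :
    ∑ i, X (Sum.inl i) * pderiv (Sum.inl i) p = (k : ℂ) • p := by
  have := hp.1.sum_weight_X_mul_pderiv
  simp only [Fintype.sum_sum_type, w1, Sum.elim_inl, Sum.elim_inr, one_smul, zero_smul,
    Finset.sum_const_zero, add_zero] at this
  rw [this, Nat.cast_smul_eq_nsmul]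

lemma euler_r {p : Poly d} (hp : p ∈ Pol d k l) :
    ∑ i, X (Sum.inr i) * pderiv (Sum.inr i) p = (l : ℂ) • p := by
  have := hp.2.sum_weight_X_mul_pderiv
  simp only [Fintype.sum_sum_type, w2, Sum.elim_inl, Sum.elim_inr, one_smul, zero_smul,
    Finset.sum_const_zero, zero_add] at this
  rw [this, Nat.cast_smul_eq_nsmul]

lemma pderiv_comm' (i j : Fin d ⊕ Fin d) (p : Poly d) :
    pderiv i (pderiv j p) = pderiv j (pderiv i p) := by
  ext s
  simp only [coeff_pderiv]
  rw [add_right_comm]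
  by_cases h : i = j
  · subst h; ring
  · simp [Finsupp.single_apply, h, Ne.symm h]; ring

/-- swapping `z` and `conj z` -/
noncomputable def sw : Poly d →ₐ[ℂ] Poly d := rename Sum.swap

lemma sw_sw (p : Poly d) : sw (sw p) = p := by
  simp [sw, rename_rename]

lemma sw_mem {p : Poly d} (hp : p ∈ Pol d k l) : sw p ∈ Pol d l k := by
  have key : ∀ s, coeff s (sw p) ≠ 0 → ∃ t, t.mapDomain Sum.swap = s ∧ coeff t p ≠ 0 := by
    intro s hs
    exact coeff_rename_ne_zero _ _ _ hs
  have e1 : ∀ (t : Fin d ⊕ Fin d →₀ ℕ) (i : Fin d),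
      t.mapDomain Sum.swap (Sum.inl i) = t (Sum.inr i) := by
    intro t i
    exact Finsupp.mapDomain_apply (f := Sum.swap) Sum.swap_leftInverse.injective t (Sum.inr i)
  have e2 : ∀ (t : Fin d ⊕ Fin d →₀ ℕ) (i : Fin d),
      t.mapDomain Sum.swap (Sum.inr i) = t (Sum.inl i) := by
    intro t i
    exact Finsupp.mapDomain_apply (f := Sum.swap) Sum.swap_leftInverse.injective t (Sum.inl i)
  constructor
  · intro s hs
    obtain ⟨t, rfl, ht⟩ := key s hs
    rw [← hp.2 ht, weight_w1, weight_w2]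
    simp [e1]
  · intro s hs
    obtain ⟨t, rfl, ht⟩ := key s hs
    rw [← hp.1 ht, weight_w1, weight_w2]
    simp [e2]

lemma pd_sw_l (i : Fin d) (p : Poly d) :
    pderiv (Sum.inl i) (sw p) = sw (pderiv (Sum.inr i) p) :=
  pderiv_rename Sum.swap_leftInverse.injective (Sum.inr i) p

lemma pd_sw_r (i : Fin d) (p : Poly d) :
    pderiv (Sum.inr i) (sw p) = sw (pderiv (Sum.inl i) p) :=
  pderiv_rename Sum.swap_leftInverse.injective (Sum.inl i) p

/-- Laplacian -/
noncomputable def Lap : Poly d →ₗ[ℂ] Poly d :=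
  ∑ i, (pderiv (Sum.inr i)).toLinearMap ∘ₗ (pderiv (Sum.inl i)).toLinearMap

lemma Lap_apply (p : Poly d) : Lap p = ∑ i, pderiv (Sum.inr i) (pderiv (Sum.inl i) p) := by
  simp [Lap]

lemma Lap_sw (p : Poly d) : Lap (sw p) = sw (Lap p) := by
  simp only [Lap_apply, map_sum, pd_sw_l, pd_sw_r]
  exact Finset.sum_congr rfl fun i _ => by rw [pderiv_comm']

lemma Lap_pderiv (j : Fin d ⊕ Fin d) (p : Poly d) : Lap (pderiv j p) = pderiv j (Lap p) := by
  simp only [Lap_apply, map_sum]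
  refine Finset.sum_congr rfl fun i _ => ?_
  rw [pderiv_comm' (Sum.inl i) j, pderiv_comm' (Sum.inr i) j]

lemma Lap_mem {p : Poly d} (hp : p ∈ Pol d (k + 1) (l + 1)) : Lap p ∈ Pol d k l := by
  rw [Lap_apply]
  exact Submodule.sum_mem _ fun i _ => pd_r (pd_l hp i) i

lemma Lap_l0 {p : Poly d} (hp : p ∈ Pol d 0 l) : Lap p = 0 := by
  rw [Lap_apply]
  exact Finset.sum_eq_zero fun i _ => by rw [pd_l0 hp, map_zero]

lemma Lap_r0 {p : Poly d} (hp : p ∈ Pol d k 0) : Lap p = 0 := by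
  rw [Lap_apply]
  exact Finset.sum_eq_zero fun i _ => by rw [pderiv_comm', pd_r0 hp, map_zero]

/-- the polynomial `|z|^2` -/
noncomputable def Rr : Poly d := ∑ i, X (Sum.inl i) * X (Sum.inr i)

lemma Rr_mem : (Rr : Poly d) ∈ Pol d 1 1 :=
  Submodule.sum_mem _ fun i _ => mul_mem (X_mem_l i) (X_mem_r i)

lemma pd_Rr_l (i : Fin d) : pderiv (Sum.inl i) (Rr : Poly d) = X (Sum.inr i) := by
  simp [Rr, pderiv_mul, pderiv_X, Pi.single_apply]

lemma pd_Rr_r (i : Fin d) : pderiv (Sum.inr i) (Rr : Poly d) = X (Sum.inl i) := by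
  simp [Rr, pderiv_mul, pderiv_X, Pi.single_apply]

/-- harmonic polynomials -/
noncomputable def Harm (d k l : ℕ) : Submodule ℂ (Poly d) := Pol d k l ⊓ LinearMap.ker Lap

lemma mem_Harm {p : Poly d} : p ∈ Harm d k l ↔ p ∈ Pol d k l ∧ Lap p = 0 := Iff.rfl

lemma Lap_Rr_mul {p : Poly d} (hp : p ∈ Pol d k l) :
    Lap (Rr * p) = ((d + k + l : ℕ) : ℂ) • p + Rr * Lap p := by
  simp only [Lap_apply, pderiv_mul, map_add, pd_Rr_l, pd_Rr_r, pderiv_X_self,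
    Finset.sum_add_distrib, euler_l hp, euler_r hp, Finset.mul_sum, one_mul]
  simp [← Nat.cast_smul_eq_nsmul ℂ, add_smul]
  module

/-- the average functional over the sphere -/
noncomputable def Lf : Poly d →ₗ[ℂ] ℂ :=
  (basisMonomials (Fin d ⊕ Fin d) ℂ).constr ℂ fun s =>
    monomialAvg d (fun i => s (Sum.inl i)) (fun i => s (Sum.inr i))

lemma Lf_monomial (s : Fin d ⊕ Fin d →₀ ℕ) (c : ℂ) : Lf (monomial s c) =
    c * monomialAvg d (fun i => s (Sum.inl i)) (fun i => s (Sum.inr i)) := by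
  have h : monomial s c = c • basisMonomials (Fin d ⊕ Fin d) ℂ s := by
    simp [smul_monomial]
  rw [h, map_smul, Lf, Module.Basis.constr_basis, smul_eq_mul]

lemma Lf_one (hd : 2 ≤ d) : Lf (1 : Poly d) = 1 := by
  rw [show (1 : Poly d) = monomial 0 1 from rfl, Lf_monomial]
  simp [monomialAvg, Nat.factorial_ne_zero]

/-- induction principle on bihomogeneous polynomials -/
lemma pol_ext {M : Type*} [AddCommMonoid M] [Module ℂ M] {f g : Poly d →ₗ[ℂ] M}
    (h : ∀ s : Fin d ⊕ Fin d →₀ ℕ, ∑ i, s (Sum.inl i) = k → ∑ i, s (Sum.inr i) = l →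
      f (monomial s 1) = g (monomial s 1)) {p : Poly d} (hp : p ∈ Pol d k l) : f p = g p := by
  rw [p.as_sum, map_sum, map_sum]
  refine Finset.sum_congr rfl fun s hs => ?_
  rw [mem_support_iff] at hs
  have h1 := hp.1 hs
  have h2 := hp.2 hs
  rw [weight_w1] at h1
  rw [weight_w2] at h2
  have : monomial s (coeff s p) = coeff s p • monomial s (1 : ℂ) := by simp [smul_monomial]
  rw [this, map_smul, map_smul, h s h1 h2]

lemma Lf_sw (p : Poly d) : Lf (sw p) = Lf p := by
  have : Lf ∘ₗ (sw : Poly d →ₐ[ℂ] Poly d).toLinearMap = Lf := by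
    refine (basisMonomials (Fin d ⊕ Fin d) ℂ).ext fun s => ?_
    simp only [coe_basisMonomials, LinearMap.comp_apply, AlgHom.toLinearMap_apply, sw,
      rename_monomial, Lf_monomial, one_mul]
    have e1 : ∀ (i : Fin d), s.mapDomain Sum.swap (Sum.inl i) = s (Sum.inr i) := by
      intro i
      exact Finsupp.mapDomain_apply (f := Sum.swap) Sum.swap_leftInverse.injective s (Sum.inr i)
    have e2 : ∀ (i : Fin d), s.mapDomain Sum.swap (Sum.inr i) = s (Sum.inl i) := by
      intro i
      exact Finsupp.mapDomain_apply (f := Sum.swap) Sum.swap_leftInverse.injective s (Sum.inl i)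
    simp only [e1, e2, monomialAvg]
    split_ifs with h1 h2 h2
    · simp only [funext_iff] at h1
      simp only [h1]
    · exact absurd h1.symm h2
    · exact absurd h2.symm h1
    · rfl
  exact LinearMap.congr_fun this p

lemma avg_step (hd : 2 ≤ d) (a b : Fin d → ℕ) (i : Fin d) :
    ((d + (∑ j, b j) - 1 : ℕ) : ℂ) * monomialAvg d (Pi.single i 1 + a) b =
      (b i : ℂ) * monomialAvg d a (b - Pi.single i 1) := by
  by_cases h : Pi.single i 1 + a = b
  · subst h
    have h2 : a = Pi.single i 1 + a - Pi.single i 1 := by simp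
    simp only [monomialAvg, if_true, ← h2, Pi.add_apply, Finset.sum_add_distrib]
    have h3 : ∏ j, ((((Pi.single i 1 : Fin d → ℕ) j + a j).factorial : ℕ) : ℂ) =
        (1 + a i : ℂ) * ∏ j, ((a j).factorial : ℂ) := by
      rw [← Finset.mul_prod_erase _ _ (Finset.mem_univ i),
        ← Finset.mul_prod_erase _ (fun j => ((a j).factorial : ℂ)) (Finset.mem_univ i)]
      have : ∏ x ∈ Finset.univ.erase i, ((((Pi.single i 1 : Fin d → ℕ) x + a x).factorial : ℕ) : ℂ)
          = ∏ x ∈ Finset.univ.erase i, ((a x).factorial : ℂ) := by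
        refine Finset.prod_congr rfl fun j hj => ?_
        simp [Pi.single_apply, (Finset.mem_erase.1 hj).1]
      rw [this]
      simp [add_comm 1 (a i), Nat.factorial_succ]
      ring
    rw [h3]
    have h4 : d + (∑ j, (Pi.single i 1 : Fin d → ℕ) j + ∑ j, a j) - 1 = d + ∑ j, a j - 1 + 1 := by
      simp; omega
    rw [h4, Nat.factorial_succ]
    have h5 : ((d + ∑ j, a j - 1).factorial : ℂ) ≠ 0 := by
      exact_mod_cast Nat.factorial_ne_zero _
    have h6 : ((d + ∑ j, a j - 1 + 1 : ℕ) : ℂ) ≠ 0 := by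
      exact_mod_cast Nat.succ_ne_zero (d + ∑ j, a j - 1)
    push_cast at h6 ⊢
    simp
    field_simp
  · by_cases hb : b i = 0
    · simp [monomialAvg, h, hb]
    · have h' : a ≠ b - Pi.single i 1 := by
        intro h2
        apply h
        subst h2
        ext j
        by_cases hj : j = i
        · subst hj; simp; omega
        · simp [Pi.single_apply, hj]
      simp [monomialAvg, h, h']

lemma Lf_X_l (hd : 2 ≤ d) {p : Poly d} (hp : p ∈ Pol d k l) (i : Fin d) :
    ((d + l - 1 : ℕ) : ℂ) * Lf (X (Sum.inl i) * p) = Lf (pderiv (Sum.inr i) p) := by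
  have := pol_ext (k := k) (l := l)
    (f := ((d + l - 1 : ℕ) : ℂ) • (Lf ∘ₗ LinearMap.mulLeft ℂ (X (Sum.inl i) : Poly d)))
    (g := Lf ∘ₗ (pderiv (Sum.inr i)).toLinearMap) ?_ hp
  · simpa using this
  intro s h1 h2
  simp only [LinearMap.smul_apply, LinearMap.comp_apply, LinearMap.mulLeft_apply, smul_eq_mul,
    Derivation.coeFn_coe, pderiv_monomial, X, monomial_mul, Lf_monomial, one_mul]
  have := avg_step hd (fun j => s (Sum.inl j)) (fun j => s (Sum.inr j)) i
  rw [h2] at this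
  have e1 : (fun j => (Finsupp.single (Sum.inl i) 1 + s : Fin d ⊕ Fin d →₀ ℕ) (Sum.inl j)) =
      Pi.single i 1 + fun j => s (Sum.inl j) := by
    ext j; simp [Finsupp.single_apply, Pi.single_apply, eq_comm]
  have e2 : (fun j => (Finsupp.single (Sum.inl i) 1 + s : Fin d ⊕ Fin d →₀ ℕ) (Sum.inr j)) =
      fun j => s (Sum.inr j) := by
    ext j; simp
  have e3 : (fun j => (s - Finsupp.single (Sum.inr i) 1 : Fin d ⊕ Fin d →₀ ℕ) (Sum.inl j)) =
      fun j => s (Sum.inl j) := by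
    ext j; simp
  have e4 : (fun j => (s - Finsupp.single (Sum.inr i) 1 : Fin d ⊕ Fin d →₀ ℕ) (Sum.inr j)) =
      (fun j => s (Sum.inr j)) - Pi.single i 1 := by
    ext j; simp [Finsupp.single_apply, Pi.single_apply, eq_comm]
  rw [e1, e2, e3, e4, this]

lemma Lf_Rr (hd : 2 ≤ d) {p : Poly d} (hp : p ∈ Pol d k l) : Lf (Rr * p) = Lf p := by
  have hne : ((d + l : ℕ) : ℂ) ≠ 0 := by
    rw [Nat.cast_ne_zero]; omega
  have h : ∀ i, ((d + l : ℕ) : ℂ) * Lf (X (Sum.inl i) * (X (Sum.inr i) * p)) =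
      Lf p + Lf (X (Sum.inr i) * pderiv (Sum.inr i) p) := by
    intro i
    have := Lf_X_l hd (mul_mem (X_mem_r i) hp) i
    rw [show d + (1 + l) - 1 = d + l by omega] at this
    rw [this, pderiv_mul, pderiv_X_self, one_mul, map_add]
  apply mul_left_cancel₀ hne
  rw [Rr, Finset.sum_mul, map_sum, Finset.mul_sum]
  simp only [mul_assoc, h, Finset.sum_add_distrib]
  rw [← map_sum Lf (fun i => X (Sum.inr i) * pderiv (Sum.inr i) p), euler_r hp]
  simp
  ring

end TD

namespace TD
open MvPolynomial
variable {d k l : ℕ}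

/-- factorial of a multi-index -/
noncomputable def fac (s : Fin d ⊕ Fin d →₀ ℕ) : ℂ := ∏ j, ((s j).factorial : ℂ)

lemma fac_add (s : Fin d ⊕ Fin d →₀ ℕ) (i : Fin d ⊕ Fin d) :
    fac (s + Finsupp.single i 1) = (s i + 1) * fac s := by
  unfold fac
  rw [← Finset.mul_prod_erase _ _ (Finset.mem_univ i),
    ← Finset.mul_prod_erase _ (fun j => ((s j).factorial : ℂ)) (Finset.mem_univ i)]
  have : ∏ x ∈ Finset.univ.erase i, (((s + Finsupp.single i 1 : Fin d ⊕ Fin d →₀ ℕ) x).factorial : ℂ)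
      = ∏ x ∈ Finset.univ.erase i, ((s x).factorial : ℂ) := by
    refine Finset.prod_congr rfl fun j hj => ?_
    simp [(Finset.mem_erase.1 hj).1]
  rw [this]
  simp [Nat.factorial_succ]
  ring

/-- Fischer bilinear form -/
noncomputable def Bf : Poly d →ₗ[ℂ] Poly d →ₗ[ℂ] ℂ :=
  (basisMonomials (Fin d ⊕ Fin d) ℂ).constr ℂ fun s => fac s • lcoeff ℂ s

lemma Bf_monomial (s : Fin d ⊕ Fin d →₀ ℕ) (c : ℂ) (q : Poly d) :
    Bf (monomial s c) q = c * (fac s * coeff s q) := by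
  have h : monomial s c = c • basisMonomials (Fin d ⊕ Fin d) ℂ s := by
    simp [smul_monomial]
  rw [h, map_smul, Bf, Module.Basis.constr_basis]
  simp

lemma Bf_apply (p q : Poly d) :
    Bf p q = ∑ s ∈ p.support, coeff s p * (fac s * coeff s q) := by
  conv_lhs => rw [p.as_sum, map_sum, LinearMap.sum_apply]
  exact Finset.sum_congr rfl fun s _ => Bf_monomial _ _ _

lemma Bf_ext {B C : Poly d →ₗ[ℂ] Poly d →ₗ[ℂ] ℂ}
    (h : ∀ s t, B (monomial s 1) (monomial t 1) = C (monomial s 1) (monomial t 1)) : B = C := by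
  refine (basisMonomials (Fin d ⊕ Fin d) ℂ).ext fun s => ?_
  refine (basisMonomials (Fin d ⊕ Fin d) ℂ).ext fun t => ?_
  simpa using h s t

lemma Bf_symm (p q : Poly d) : Bf p q = Bf q p := by
  have : (Bf : Poly d →ₗ[ℂ] Poly d →ₗ[ℂ] ℂ) = Bf.flip := by
    refine Bf_ext fun s t => ?_
    simp only [LinearMap.flip_apply, Bf_monomial, coeff_monomial, one_mul]
    by_cases h : s = t
    · subst h; rfl
    · simp [h, Ne.symm h]
  exact LinearMap.congr_fun (LinearMap.congr_fun this p) q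

lemma Bf_X (i : Fin d ⊕ Fin d) (p q : Poly d) : Bf (X i * p) q = Bf p (pderiv i q) := by
  have : (Bf : Poly d →ₗ[ℂ] Poly d →ₗ[ℂ] ℂ) ∘ₗ LinearMap.mulLeft ℂ (X i : Poly d) =
      (Bf : Poly d →ₗ[ℂ] Poly d →ₗ[ℂ] ℂ).compl₂ (pderiv i).toLinearMap := by
    refine Bf_ext fun s t => ?_
    simp only [LinearMap.comp_apply, LinearMap.mulLeft_apply, LinearMap.compl₂_apply, X,
      monomial_mul, Bf_monomial, Derivation.coeFn_coe, coeff_pderiv]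
    rw [add_comm (Finsupp.single i 1) s, fac_add]
    ring
  exact LinearMap.congr_fun (LinearMap.congr_fun this p) q

lemma Bf_sw (p q : Poly d) : Bf (sw p) (sw q) = Bf p q := by
  have : (Bf : Poly d →ₗ[ℂ] Poly d →ₗ[ℂ] ℂ).compl₁₂ (sw : Poly d →ₐ[ℂ] Poly d).toLinearMap
      (sw : Poly d →ₐ[ℂ] Poly d).toLinearMap = Bf := by
    refine Bf_ext fun s t => ?_
    have hinj : Function.Injective (Sum.swap : Fin d ⊕ Fin d → Fin d ⊕ Fin d) :=
      Sum.swap_leftInverse.injective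
    simp only [LinearMap.compl₁₂_apply, AlgHom.toLinearMap_apply, sw, rename_monomial,
      Bf_monomial, coeff_monomial, (Finsupp.mapDomain_injective hinj).eq_iff]
    congr 2
    unfold fac
    refine Fintype.prod_equiv (Equiv.sumComm (Fin d) (Fin d)) _ _ fun j => ?_
    congr 2
    have := Finsupp.mapDomain_apply hinj s (Sum.swap j)
    rw [Sum.swap_swap] at this
    exact this
  exact LinearMap.congr_fun (LinearMap.congr_fun this p) q

lemma Bf_Rr (p q : Poly d) : Bf (Rr * p) q = Bf p (Lap q) := by
  simp only [Rr, Finset.sum_mul, map_sum, LinearMap.sum_apply, Lap_apply, mul_assoc, Bf_X]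

lemma Harm_pd_l {p : Poly d} (hp : p ∈ Harm d (k + 1) l) (i : Fin d) :
    pderiv (Sum.inl i) p ∈ Harm d k l :=
  mem_Harm.2 ⟨pd_l hp.1 i, by rw [Lap_pderiv, (mem_Harm.1 hp).2, map_zero]⟩

lemma Harm_pd_r {p : Poly d} (hp : p ∈ Harm d k (l + 1)) (i : Fin d) :
    pderiv (Sum.inr i) p ∈ Harm d k l :=
  mem_Harm.2 ⟨pd_r hp.1 i, by rw [Lap_pderiv, (mem_Harm.1 hp).2, map_zero]⟩

lemma Harm_sw {p : Poly d} (hp : p ∈ Harm d k l) : sw p ∈ Harm d l k :=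
  mem_Harm.2 ⟨sw_mem hp.1, by rw [Lap_sw, (mem_Harm.1 hp).2, map_zero]⟩

/-- ratio of sphere inner product and Fischer inner product -/
noncomputable def lam (d k l : ℕ) : ℝ := ((d - 1).factorial : ℝ) / ((d + k + l - 1).factorial : ℝ)

lemma lam_pos : 0 < lam d k l := by unfold lam; positivity

lemma lam_comm : lam d k l = lam d l k := by unfold lam; rw [add_right_comm]

lemma lam_step (hd : 2 ≤ d) : (d + k + l : ℝ) * lam d (k + 1) l = lam d k l := by
  unfold lam
  rw [show d + (k + 1) + l - 1 = d + k + l - 1 + 1 by omega, Nat.factorial_succ,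
    show d + k + l - 1 + 1 = d + k + l by omega]
  have h : ((d + k + l - 1).factorial : ℝ) ≠ 0 := by exact_mod_cast Nat.factorial_ne_zero _
  have h2 : (d + k + l : ℝ) ≠ 0 := by positivity
  push_cast
  field_simp

def Claim (d k l : ℕ) : Prop := ∀ q ∈ Harm d k l, ∀ k' l' : ℕ, ∀ P ∈ Harm d k' l',
  Lf (q * P) = if k = l' ∧ l = k' then (lam d k l : ℂ) * Bf q (sw P) else 0

lemma Claim.swap (h : Claim d k l) : Claim d l k := by
  intro q hq k' l' P hP
  have := h (sw q) (Harm_sw hq) l' k' (sw P) (Harm_sw hP)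
  rw [← map_mul, Lf_sw, Bf_sw, lam_comm] at this
  rw [this]
  simp only [and_comm]

lemma Claim.step (hd : 2 ≤ d) (h : Claim d k l) : Claim d (k + 1) l := by
  intro q hq k' l' P hP
  have hk : ((k + 1 : ℕ) : ℂ) ≠ 0 := by exact_mod_cast Nat.succ_ne_zero k
  have hD : ((d + (l + l') - 1 : ℕ) : ℂ) ≠ 0 := by
    rw [Nat.cast_ne_zero]; omega
  have key : ((d + (l + l') - 1 : ℕ) : ℂ) * (((k + 1 : ℕ) : ℂ) * Lf (q * P)) =
      ∑ i, Lf (pderiv (Sum.inl i) q * pderiv (Sum.inr i) P) := by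
    rw [← smul_eq_mul ((k + 1 : ℕ) : ℂ), ← map_smul, ← smul_mul_assoc, ← euler_l hq.1,
      Finset.sum_mul, map_sum, Finset.mul_sum]
    have : ∀ i, ((d + (l + l') - 1 : ℕ) : ℂ) * Lf (X (Sum.inl i) * pderiv (Sum.inl i) q * P) =
        Lf (pderiv (Sum.inr i) (pderiv (Sum.inl i) q) * P) +
        Lf (pderiv (Sum.inl i) q * pderiv (Sum.inr i) P) := by
      intro i
      rw [mul_assoc, Lf_X_l hd (mul_mem (pd_l hq.1 i) hP.1), pderiv_mul, map_add]
    simp only [this, Finset.sum_add_distrib]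
    rw [← map_sum Lf (fun i => pderiv (Sum.inr i) (pderiv (Sum.inl i) q) * P), ← Finset.sum_mul,
      ← Lap_apply, (mem_Harm.1 hq).2, zero_mul, map_zero, zero_add]
  have keyB : ((k + 1 : ℕ) : ℂ) * Bf q (sw P) =
      ∑ i, Bf (pderiv (Sum.inl i) q) (sw (pderiv (Sum.inr i) P)) := by
    rw [← smul_eq_mul, ← LinearMap.smul_apply, ← map_smul, ← euler_l hq.1, map_sum,
      LinearMap.sum_apply]
    simp only [Bf_X, pd_sw_l]
  obtain _ | l' := l'
  · rw [if_neg (by omega)]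
    have : ∀ i, pderiv (Sum.inr i) P = 0 := fun i => pd_r0 hP.1 i
    simp only [this, mul_zero, map_zero, Finset.sum_const_zero] at key
    exact (mul_eq_zero.1 ((mul_eq_zero.1 key).resolve_left hD)).resolve_left hk
  · have := fun i => h _ (Harm_pd_l hq i) k' l' _ (Harm_pd_r hP i)
    simp only [this] at key
    by_cases hc : k = l' ∧ l = k'
    · obtain ⟨rfl, rfl⟩ := hc
      simp only [and_self, if_true, ← Finset.mul_sum, ← keyB] at key ⊢
      apply mul_left_cancel₀ hk
      apply mul_left_cancel₀ hD
      rw [key, ← lam_step hd, show d + (l + (k + 1)) - 1 = d + k + l by omega]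
      push_cast
      ring
    · rw [if_neg (by omega)]
      simp only [hc, if_false, Finset.sum_const_zero] at key
      exact (mul_eq_zero.1 ((mul_eq_zero.1 key).resolve_left hD)).resolve_left hk

lemma pol00 {p : Poly d} (hp : p ∈ Pol d 0 0) : p = C (coeff 0 p) := by
  ext s
  rw [coeff_C]
  split_ifs with h
  · rw [← h]
  · by_contra hs
    apply h
    have h1 := hp.1 hs
    have h2 := hp.2 hs
    rw [weight_w1, Finset.sum_eq_zero_iff] at h1
    rw [weight_w2, Finset.sum_eq_zero_iff] at h2
    ext j
    rcases j with j | j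
    · exact (h1 j (Finset.mem_univ _)).symm
    · exact (h2 j (Finset.mem_univ _)).symm

lemma Lf_harm_l (hd : 2 ≤ d) {P : Poly d} (hP : P ∈ Harm d (k + 1) l) : Lf P = 0 := by
  have hk : ((k + 1 : ℕ) : ℂ) ≠ 0 := by exact_mod_cast Nat.succ_ne_zero k
  have hD : ((d + l - 1 : ℕ) : ℂ) ≠ 0 := by
    rw [Nat.cast_ne_zero]; omega
  have key : ((d + l - 1 : ℕ) : ℂ) * (((k + 1 : ℕ) : ℂ) * Lf P) = 0 := by
    rw [← smul_eq_mul ((k + 1 : ℕ) : ℂ), ← map_smul, ← euler_l hP.1, map_sum, Finset.mul_sum]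
    simp only [fun i => Lf_X_l hd (pd_l hP.1 i) i]
    rw [← map_sum, ← Lap_apply, (mem_Harm.1 hP).2, map_zero]
  exact (mul_eq_zero.1 ((mul_eq_zero.1 key).resolve_left hD)).resolve_left hk

lemma Claim.zero (hd : 2 ≤ d) : Claim d 0 0 := by
  intro q hq k' l' P hP
  rw [pol00 hq.1]
  generalize coeff 0 q = c
  have h0 : Lf (C c * P) = c * Lf P := by
    rw [C_mul', map_smul, smul_eq_mul]
  rw [h0]
  obtain _ | k' := k'
  · obtain _ | l' := l'
    · rw [pol00 hP.1]
      generalize coeff 0 P = e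
      have h1 : Lf (C e : Poly d) = e := by
        rw [show (C e : Poly d) = e • 1 by rw [← C_mul', mul_one], map_smul, Lf_one hd]; simp
      have h2 : sw (C e : Poly d) = C e := by simp [sw]
      rw [h1, h2, show (C c : Poly d) = monomial 0 c from rfl, Bf_monomial]
      have : ((d - 1).factorial : ℂ) ≠ 0 := by exact_mod_cast Nat.factorial_ne_zero _
      simp [fac, lam, this]
    · rw [if_neg (by omega), ← Lf_sw, Lf_harm_l hd (Harm_sw hP), mul_zero]
  · rw [if_neg (by omega), Lf_harm_l hd hP, mul_zero]

lemma claim (hd : 2 ≤ d) (k l : ℕ) : Claim d k l := by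
  have h1 : ∀ l, Claim d l 0 := by
    intro l
    induction l with
    | zero => exact Claim.zero hd
    | succ n ih => exact ih.step hd
  induction k with
  | zero => exact (h1 l).swap
  | succ n ih => exact ih.step hd

/-- conjugation of coefficients -/
noncomputable def cj : Poly d →+* Poly d := map (starRingEnd ℂ)

lemma cj_mem {p : Poly d} (hp : p ∈ Pol d k l) : cj p ∈ Pol d k l := by
  constructor
  · intro s hs
    refine hp.1 (d := s) fun h => hs ?_
    simp [cj, coeff_map, h]
  · intro s hs
    refine hp.2 (d := s) fun h => hs ?_
    simp [cj, coeff_map, h]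

lemma Lap_cj (p : Poly d) : Lap (cj p) = cj (Lap p) := by
  simp only [Lap_apply, cj, pderiv_map, map_sum]

lemma Harm_cj {p : Poly d} (hp : p ∈ Harm d k l) : cj p ∈ Harm d k l :=
  mem_Harm.2 ⟨cj_mem hp.1, by rw [Lap_cj, (mem_Harm.1 hp).2, map_zero]⟩

lemma cj_cj (p : Poly d) : cj (cj p) = p := by
  ext s; simp [cj, coeff_map]

lemma cj_smul (c : ℂ) (p : Poly d) : cj (c • p) = (starRingEnd ℂ c) • cj p := by
  ext s; simp [cj, coeff_map]

lemma Bf_cj (p q : Poly d) : Bf (cj p) (cj q) = (starRingEnd ℂ) (Bf p q) := by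
  have hs : (cj p).support = p.support := by
    ext s; simp [cj, coeff_map, mem_support_iff]
  rw [Bf_apply, hs, Bf_apply]
  simp only [map_sum, map_mul, cj, coeff_map, fac, map_prod, map_natCast]

lemma Bf_self (p : Poly d) : Bf (cj p) p =
    ((∑ s ∈ p.support, (∏ j, ((s j).factorial : ℝ)) * Complex.normSq (coeff s p) : ℝ) : ℂ) := by
  have hs : (cj p).support = p.support := by
    ext s; simp [cj, coeff_map, mem_support_iff]
  rw [Bf_apply, hs]
  simp only [cj, coeff_map, fac]
  push_cast
  refine Finset.sum_congr rfl fun s _ => ?_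
  rw [Complex.normSq_eq_conj_mul_self]
  ring

lemma Bf_definite {p : Poly d} (h : Bf (cj p) p = 0) : p = 0 := by
  rw [Bf_self, Complex.ofReal_eq_zero, Finset.sum_eq_zero_iff_of_nonneg] at h
  · by_contra hp
    obtain ⟨s, hs⟩ := support_nonempty.2 hp
    have := h s hs
    rw [mul_eq_zero] at this
    rcases this with h1 | h1
    · exact absurd h1 (Finset.prod_ne_zero_iff.2 fun j _ => by
        exact_mod_cast Nat.factorial_ne_zero _)
    · rw [Complex.normSq_eq_zero] at h1
      exact (mem_support_iff.1 hs) h1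
  · intro s _
    exact mul_nonneg (Finset.prod_nonneg fun j _ => by positivity) (Complex.normSq_nonneg _)

/-- The Fischer inner product on a space of polynomials. -/
@[reducible]
noncomputable def core (V : Submodule ℂ (Poly d)) : InnerProductSpace.Core ℂ V where
  inner p q := Bf (cj (p : Poly d)) (q : Poly d)
  conj_inner_symm p q := by
    rw [← Bf_cj, cj_cj, Bf_symm]
  re_inner_nonneg p := by
    rw [Bf_self]
    simp only [RCLike.re_to_complex, Complex.ofReal_re]
    exact Finset.sum_nonneg fun s _ => mul_nonneg (Finset.prod_nonneg fun j _ => by positivity)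
      (Complex.normSq_nonneg _)
  add_left p q r := by simp
  smul_left p q r := by simp [cj_smul]
  definite p h := by
    have := Bf_definite h
    exact Subtype.ext this

lemma exists_onb (V : Submodule ℂ (Poly d)) [FiniteDimensional ℂ V] :
    ∃ h : Fin (Module.finrank ℂ V) → Poly d, (∀ i, h i ∈ V) ∧
      (∀ i j, Bf (cj (h i)) (h j) = if i = j then 1 else 0) ∧
      ∀ p ∈ V, p = ∑ i, Bf (cj (h i)) p • h i := by
  let c := core V
  let : NormedAddCommGroup V := c.toNormedAddCommGroup
  let : InnerProductSpace ℂ V := InnerProductSpace.ofCore c.toCore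
  let b := stdOrthonormalBasis ℂ V
  refine ⟨fun i => b i, fun i => (b i).2, fun i j => ?_, fun p hp => ?_⟩
  · exact orthonormal_iff_ite.1 b.orthonormal i j
  · have := b.sum_repr' ⟨p, hp⟩
    have h2 := congrArg (Subtype.val) this
    simp only [AddSubmonoidClass.coe_finset_sum, Submodule.coe_smul] at h2
    exact h2.symm

end TD

namespace TD
open MvPolynomial
variable {d k l : ℕ}

lemma Pol_eq (d k l : ℕ) : Pol d k l = restrictSupport ℂ
    {s : Fin d ⊕ Fin d →₀ ℕ | ∑ i, s (Sum.inl i) = k ∧ ∑ i, s (Sum.inr i) = l} := by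
  ext p
  rw [mem_restrictSupport_iff, mem_Pol]
  constructor
  · intro h s hs
    have hs' : coeff s p ≠ 0 := mem_support_iff.1 hs
    have h1 := h.1 hs'
    have h2 := h.2 hs'
    rw [weight_w1] at h1
    rw [weight_w2] at h2
    exact ⟨h1, h2⟩
  · intro h
    constructor
    · intro s hs
      rw [weight_w1]
      exact (h (mem_support_iff.2 hs)).1
    · intro s hs
      rw [weight_w2]
      exact (h (mem_support_iff.2 hs)).2

/-- exponents of bidegree `(k,l)` -/
noncomputable def expEquiv (d k l : ℕ) :
    {s : Fin d ⊕ Fin d →₀ ℕ | ∑ i, s (Sum.inl i) = k ∧ ∑ i, s (Sum.inr i) = l} ≃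
    ((Finset.univ : Finset (Fin d)).finsuppAntidiag k) ×
      ((Finset.univ : Finset (Fin d)).finsuppAntidiag l) :=
  ((Finsupp.sumFinsuppEquivProdFinsupp (α := Fin d) (β := Fin d) (γ := ℕ)).subtypeEquiv
    (q := fun p => p.1 ∈ (Finset.univ : Finset (Fin d)).finsuppAntidiag k ∧
      p.2 ∈ (Finset.univ : Finset (Fin d)).finsuppAntidiag l) (by
      intro s
      simp [Finset.mem_finsuppAntidiag]
      exact Iff.rfl)).trans
    (Equiv.subtypeProdEquivProd (p := fun a => a ∈ (Finset.univ : Finset (Fin d)).finsuppAntidiag k)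
      (q := fun a => a ∈ (Finset.univ : Finset (Fin d)).finsuppAntidiag l))

instance : FiniteDimensional ℂ (Pol d k l) := by
  rw [Pol_eq]
  have : Finite {s : Fin d ⊕ Fin d →₀ ℕ | ∑ i, s (Sum.inl i) = k ∧ ∑ i, s (Sum.inr i) = l} :=
    Finite.of_equiv _ (expEquiv d k l).symm
  exact Module.Finite.of_basis (basisRestrictSupport ℂ _)

lemma finrank_Pol (hd : 2 ≤ d) (k l : ℕ) : Module.finrank ℂ (Pol d k l) =
    (d + k - 1).choose (d - 1) * (d + l - 1).choose (d - 1) := by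
  rw [Pol_eq, Module.finrank_eq_nat_card_basis (basisRestrictSupport ℂ _),
    Nat.card_congr (expEquiv d k l), Nat.card_prod]
  simp only [Nat.card_eq_fintype_card, Fintype.card_coe, Finset.card_finsuppAntidiag_nat_eq_choose,
    Finset.card_univ, Fintype.card_fin]
  congr 1
  · rw [← Nat.choose_symm (by omega)]
    congr 1; omega
  · rw [← Nat.choose_symm (by omega)]
    congr 1; omega

lemma Rr_ne (hd : 2 ≤ d) : (Rr : Poly d) ≠ 0 := by
  intro h
  have := pd_Rr_l (⟨0, by omega⟩ : Fin d)
  rw [h, map_zero] at this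
  exact X_ne_zero _ this.symm

lemma cj_Rr : cj (Rr : Poly d) = Rr := by simp [cj, Rr]

/-- `p ↦ Δ(|z|² p)` -/
noncomputable def LapR (d k l : ℕ) : Pol d k l →ₗ[ℂ] Pol d k l :=
  (Lap ∘ₗ LinearMap.mulLeft ℂ (Rr : Poly d)).restrict (fun p hp => by
    have : Rr * p ∈ Pol d (k + 1) (l + 1) := by
      have := mul_mem Rr_mem hp
      rwa [add_comm 1 k, add_comm 1 l] at this
    exact Lap_mem this)

lemma LapR_surj (hd : 2 ≤ d) : Function.Surjective (LapR d k l) := by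
  rw [← LinearMap.injective_iff_surjective, injective_iff_map_eq_zero]
  intro p hp
  have h1 : Lap (Rr * (p : Poly d)) = 0 := congrArg Subtype.val hp
  have h2 : Bf (cj (Rr * (p : Poly d))) (Rr * (p : Poly d)) = 0 := by
    rw [map_mul cj, cj_Rr, Bf_Rr, h1, map_zero]
  have h3 := Bf_definite h2
  exact Subtype.ext ((mul_eq_zero.1 h3).resolve_left (Rr_ne hd))

lemma Rr_mul_mem {p : Poly d} (hp : p ∈ Pol d k l) : Rr * p ∈ Pol d (k + 1) (l + 1) := by
  have := mul_mem Rr_mem hp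
  rwa [add_comm 1 k, add_comm 1 l] at this

lemma decomp (hd : 2 ≤ d) {q : Poly d} (hq : q ∈ Pol d (k + 1) (l + 1)) :
    ∃ h ∈ Harm d (k + 1) (l + 1), ∃ p ∈ Pol d k l, q = h + Rr * p := by
  obtain ⟨p, hp⟩ := LapR_surj hd (⟨Lap q, Lap_mem hq⟩ : Pol d k l)
  have h1 : Lap (Rr * (p : Poly d)) = Lap q := congrArg Subtype.val hp
  refine ⟨q - Rr * (p : Poly d), mem_Harm.2 ⟨Submodule.sub_mem _ hq (Rr_mul_mem p.2), ?_⟩, p, p.2, by ring⟩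
  rw [map_sub, h1, sub_self]

instance : FiniteDimensional ℂ (Harm d k l) :=
  Submodule.finiteDimensional_of_le (inf_le_left : Harm d k l ≤ Pol d k l)

lemma Harm_l0 : Harm d 0 l = Pol d 0 l :=
  le_antisymm inf_le_left fun _ hp => mem_Harm.2 ⟨hp, Lap_l0 hp⟩

lemma Harm_r0 : Harm d k 0 = Pol d k 0 :=
  le_antisymm inf_le_left fun _ hp => mem_Harm.2 ⟨hp, Lap_r0 hp⟩

lemma finrank_Harm (hd : 2 ≤ d) (k l : ℕ) : Module.finrank ℂ (Harm d k l) = mdim d k l := by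
  unfold mdim
  have hz : (d + 0 - 2).choose (d - 1) = 0 := Nat.choose_eq_zero_of_lt (by omega)
  obtain _ | k := k
  · rw [Harm_l0, finrank_Pol hd, hz]; simp
  obtain _ | l := l
  · rw [Harm_r0, finrank_Pol hd, hz]; simp
  let f : Pol d (k + 1) (l + 1) →ₗ[ℂ] Pol d k l := Lap.restrict (fun p hp => Lap_mem hp)
  have hsurj : Function.Surjective f := by
    intro q
    obtain ⟨p, hp⟩ := LapR_surj hd q
    exact ⟨⟨Rr * (p : Poly d), Rr_mul_mem p.2⟩, hp⟩
  have h1 := LinearMap.finrank_range_add_finrank_ker f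
  rw [LinearMap.range_eq_top.2 hsurj, finrank_top, finrank_Pol hd, finrank_Pol hd] at h1
  have h2 : (LinearMap.ker f).map (Pol d (k + 1) (l + 1)).subtype = Harm d (k + 1) (l + 1) := by
    ext p
    simp only [Submodule.mem_map, LinearMap.mem_ker, Submodule.subtype_apply, Subtype.exists]
    constructor
    · rintro ⟨q, hq, h, rfl⟩
      exact mem_Harm.2 ⟨hq, congrArg Subtype.val h⟩
    · intro h
      exact ⟨p, h.1, Subtype.ext (mem_Harm.1 h).2, rfl⟩
  rw [← h2, Submodule.finrank_map_subtype_eq]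
  have e1 : d + (k + 1) - 2 = d + k - 1 := by omega
  have e2 : d + (l + 1) - 2 = d + l - 1 := by omega
  rw [e1, e2, ← h1]
  omega

/-- linear forms -/
noncomputable def Al (u : Fin d ⊕ Fin d → ℂ) : Poly d := ∑ i, C (u (Sum.inl i)) * X (Sum.inl i)
noncomputable def Ar (u : Fin d ⊕ Fin d → ℂ) : Poly d := ∑ i, C (u (Sum.inr i)) * X (Sum.inr i)

lemma Al_mem (u : Fin d ⊕ Fin d → ℂ) : Al u ∈ Pol d 1 0 :=
  Submodule.sum_mem _ fun i _ => by
    rw [C_mul']; exact Submodule.smul_mem _ _ (X_mem_l i)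

lemma Ar_mem (u : Fin d ⊕ Fin d → ℂ) : Ar u ∈ Pol d 0 1 :=
  Submodule.sum_mem _ fun i _ => by
    rw [C_mul']; exact Submodule.smul_mem _ _ (X_mem_r i)

lemma AA_mem (u : Fin d ⊕ Fin d → ℂ) (a b : ℕ) : Al u ^ a * Ar u ^ b ∈ Pol d a b := by
  have := mul_mem (pow_mem (Al_mem u) a) (pow_mem (Ar_mem u) b)
  simpa using this

lemma pd_Al_l (u : Fin d ⊕ Fin d → ℂ) (i : Fin d) :
    pderiv (Sum.inl i) (Al u) = C (u (Sum.inl i)) := by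
  simp [Al, pderiv_C_mul, pderiv_X, Pi.single_apply]

lemma pd_Ar_r (u : Fin d ⊕ Fin d → ℂ) (i : Fin d) :
    pderiv (Sum.inr i) (Ar u) = C (u (Sum.inr i)) := by
  simp [Ar, pderiv_C_mul, pderiv_X, Pi.single_apply]

lemma Bf_Al (u : Fin d ⊕ Fin d → ℂ) (p q : Poly d) :
    Bf (Al u * p) q = ∑ i, u (Sum.inl i) * Bf p (pderiv (Sum.inl i) q) := by
  simp only [Al, Finset.sum_mul, map_sum, LinearMap.sum_apply, C_mul', smul_mul_assoc, map_smul,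
    LinearMap.smul_apply, Bf_X, smul_eq_mul]

lemma Bf_Ar (u : Fin d ⊕ Fin d → ℂ) (p q : Poly d) :
    Bf (Ar u * p) q = ∑ i, u (Sum.inr i) * Bf p (pderiv (Sum.inr i) q) := by
  simp only [Ar, Finset.sum_mul, map_sum, LinearMap.sum_apply, C_mul', smul_mul_assoc, map_smul,
    LinearMap.smul_apply, Bf_X, smul_eq_mul]

lemma reproducing (u : Fin d ⊕ Fin d → ℂ) (k l : ℕ) : ∀ h ∈ Pol d k l,
    Bf (Al u ^ k * Ar u ^ l) h = (k.factorial * l.factorial : ℂ) * eval u h := by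
  induction k with
  | zero =>
    induction l with
    | zero =>
      intro h hh
      rw [pol00 hh]
      simp only [pow_zero, mul_one]
      rw [show (1 : Poly d) = monomial 0 1 from rfl, Bf_monomial]
      simp [fac]
    | succ l ih =>
      intro h hh
      rw [pow_succ', mul_left_comm, Bf_Ar]
      simp only [fun i => ih _ (pd_r hh i)]
      have := congrArg (eval u) (euler_r hh)
      simp only [map_sum, map_mul, eval_X, smul_eval] at this
      rw [Nat.factorial_succ]
      push_cast at this ⊢
      calc _ = ((Nat.factorial 0 : ℂ) * (l.factorial : ℂ)) *
            ∑ x, u (Sum.inr x) * eval u (pderiv (Sum.inr x) h) := by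
            rw [Finset.mul_sum]; exact Finset.sum_congr rfl fun _ _ => by ring
        _ = _ := by rw [this]; ring
  | succ k ih =>
    intro h hh
    rw [pow_succ', mul_assoc, Bf_Al]
    simp only [fun i => ih _ (pd_l hh i)]
    have := congrArg (eval u) (euler_l hh)
    simp only [map_sum, map_mul, eval_X, smul_eval] at this
    rw [Nat.factorial_succ]
    push_cast at this ⊢
    calc _ = ((k.factorial : ℂ) * (l.factorial : ℂ)) *
          ∑ x, u (Sum.inl x) * eval u (pderiv (Sum.inl x) h) := by
          rw [Finset.mul_sum]; exact Finset.sum_congr rfl fun _ _ => by ring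
      _ = _ := by rw [this]; ring

lemma Lap_AA (u : Fin d ⊕ Fin d → ℂ) (a b : ℕ) : Lap (Al u ^ a * Ar u ^ b) =
    ((a : ℂ) * b * eval u Rr) • (Al u ^ (a - 1) * Ar u ^ (b - 1)) := by
  have h1 : ∀ i, pderiv (Sum.inl i) (Ar u) = 0 := fun i => pd_l0 (Ar_mem u) i
  have h2 : ∀ i, pderiv (Sum.inr i) (Al u) = 0 := fun i => pd_r0 (Al_mem u) i
  simp only [Lap_apply, pderiv_mul, pderiv_pow, h1, h2, pd_Al_l, pd_Ar_r, mul_zero, zero_mul,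
    add_zero, zero_add, map_zero, pderiv_C, Derivation.map_natCast]
  simp only [Rr, map_sum, map_mul, eval_X, Finset.mul_sum, Finset.sum_smul]
  refine Finset.sum_congr rfl fun i _ => ?_
  rw [← C_mul']
  simp only [map_mul, map_natCast]
  ring

lemma Lap_Rpow {p : Poly d} (hp : p ∈ Pol d k l) (r : ℕ) : Lap (Rr ^ r * p) =
    Rr ^ r * Lap p + ((r : ℂ) * (d + k + l + r - 1)) • (Rr ^ (r - 1) * p) := by
  induction r with
  | zero => simp
  | succ r ih =>
    have hm : Rr ^ r * p ∈ Pol d (r + k) (r + l) := by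
      have := mul_mem (pow_mem Rr_mem r) hp
      simpa using this
    rw [pow_succ', mul_assoc, Lap_Rr_mul hm, ih]
    obtain _ | r := r
    · simp
      ring
    · simp only [Nat.add_sub_cancel, ← C_mul', map_mul, map_add, map_sub, map_natCast, map_one,
        Nat.cast_add, Nat.cast_one]
      ring

/-- coefficients of the zonal polynomial -/
noncomputable def cc (d k l r : ℕ) : ℝ :=
  ∏ j ∈ Finset.range r,
    (-(((k : ℝ) - j) * ((l : ℝ) - j)) / (((j : ℝ) + 1) * ((d : ℝ) + k + l - j - 2)))

lemma cc_zero : cc d k l 0 = 1 := by simp [cc]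

lemma cc_succ (hd : 2 ≤ d) {r : ℕ} (hk : r ≤ k) (hl : r ≤ l) :
    cc d k l (r + 1) * (((r : ℝ) + 1) * ((d : ℝ) + k + l - r - 2)) =
      -(cc d k l r * (((k : ℝ) - r) * ((l : ℝ) - r))) := by
  rw [cc, Finset.prod_range_succ, ← cc]
  by_cases h : r = k
  · subst h; simp
  have hlt : r < k := lt_of_le_of_ne hk h
  have h1 : (0 : ℝ) < (d : ℝ) + k + l - r - 2 := by
    have a1 : (2 : ℝ) ≤ d := by exact_mod_cast hd
    have a2 : (r : ℝ) + 1 ≤ k := by exact_mod_cast hlt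
    have a3 : (0 : ℝ) ≤ l := by positivity
    linarith
  have h2 : (0 : ℝ) < (r : ℝ) + 1 := by positivity
  field_simp

lemma cc_min : cc d k l (min k l + 1) = 0 := by
  rw [cc, Finset.prod_range_succ]
  rcases le_total k l with h | h <;> simp [h]

/-- zonal polynomial -/
noncomputable def Zp (u : Fin d ⊕ Fin d → ℂ) (k l : ℕ) : Poly d :=
  ∑ r ∈ Finset.range (min k l + 1),
    ((cc d k l r : ℂ) * eval u Rr ^ r) • (Rr ^ r * (Al u ^ (k - r) * Ar u ^ (l - r)))

lemma Zp_mem (u : Fin d ⊕ Fin d → ℂ) (k l : ℕ) : Zp u k l ∈ Pol d k l := by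
  refine Submodule.sum_mem _ fun r hr => Submodule.smul_mem _ _ ?_
  have h1 : r ≤ min k l := Nat.lt_succ_iff.1 (Finset.mem_range.1 hr)
  have := mul_mem (pow_mem Rr_mem r) (AA_mem u (k - r) (l - r))
  rw [mul_one, Nat.add_sub_cancel' (h1.trans (min_le_left _ _)),
    Nat.add_sub_cancel' (h1.trans (min_le_right _ _))] at this
  exact this

lemma Lap_Zp (hd : 2 ≤ d) (u : Fin d ⊕ Fin d → ℂ) (k l : ℕ) : Lap (Zp u k l) = 0 := by
  let a : ℕ → Poly d := fun r =>
    ((cc d k l r : ℂ) * eval u Rr ^ r * (r * (d + k + l - r - 1))) •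
      (Rr ^ (r - 1) * (Al u ^ (k - r) * Ar u ^ (l - r)))
  have h : Lap (Zp u k l) = ∑ r ∈ Finset.range (min k l + 1), (a r - a (r + 1)) := by
    rw [Zp, map_sum]
    refine Finset.sum_congr rfl fun r hr => ?_
    have h1 : r ≤ min k l := Nat.lt_succ_iff.1 (Finset.mem_range.1 hr)
    have hk : r ≤ k := h1.trans (min_le_left _ _)
    have hl : r ≤ l := h1.trans (min_le_right _ _)
    rw [map_smul, Lap_Rpow (AA_mem u (k - r) (l - r)), Lap_AA]
    have e := congrArg (fun x : ℝ => (x : ℂ)) (cc_succ hd hk hl)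
    push_cast at e
    simp only [a, Nat.add_sub_cancel, Nat.sub_sub]
    push_cast [Nat.cast_sub hk, Nat.cast_sub hl]
    have e' : (cc d k l (r + 1) : ℂ) * eval u Rr ^ (r + 1) *
        (((r : ℂ) + 1) * ((d : ℂ) + k + l - (r + 1) - 1)) =
        - ((cc d k l r : ℂ) * (((k : ℂ) - r) * ((l : ℂ) - r))) * eval u Rr ^ (r + 1) := by
      rw [← e]; ring
    rw [e']
    rw [mul_smul_comm, pow_succ]
    module
  rw [h, Finset.sum_range_sub']
  simp [a, cc_min]

lemma Zp_harm (hd : 2 ≤ d) (u : Fin d ⊕ Fin d → ℂ) (k l : ℕ) : Zp u k l ∈ Harm d k l :=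
  mem_Harm.2 ⟨Zp_mem u k l, Lap_Zp hd u k l⟩

lemma Bf_Zp (u : Fin d ⊕ Fin d → ℂ) {h : Poly d} (hh : h ∈ Harm d k l) :
    Bf (Zp u k l) h = (k.factorial * l.factorial : ℂ) * eval u h := by
  rw [Zp, map_sum, LinearMap.sum_apply, Finset.sum_range_succ', Finset.sum_eq_zero, zero_add]
  · simp only [cc_zero, pow_zero, Complex.ofReal_one, one_mul, one_smul, Nat.sub_zero]
    exact reproducing u k l h hh.1
  · intro r _
    rw [map_smul, LinearMap.smul_apply, pow_succ' (Rr : Poly d) r, mul_assoc, Bf_Rr, (mem_Harm.1 hh).2, map_zero,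
      smul_zero]

lemma eval_Al (u v : Fin d ⊕ Fin d → ℂ) : eval v (Al u) = ∑ i, u (Sum.inl i) * v (Sum.inl i) := by
  simp [Al]
lemma eval_Ar (u v : Fin d ⊕ Fin d → ℂ) : eval v (Ar u) = ∑ i, u (Sum.inr i) * v (Sum.inr i) := by
  simp [Ar]
lemma eval_Rr (v : Fin d ⊕ Fin d → ℂ) : eval v Rr = ∑ i, v (Sum.inl i) * v (Sum.inr i) := by
  simp [Rr]

lemma Lf_Rpow (hd : 2 ≤ d) (n : ℕ) : Lf ((Rr : Poly d) ^ n) = 1 := by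
  induction n with
  | zero => simpa using Lf_one hd
  | succ n ih => rw [pow_succ', Lf_Rr hd (pow_mem Rr_mem n), ih]

/-- The Jacobi polynomial, normalised to be monic. -/
noncomputable def gg (d k l : ℕ) (x : ℂ) : ℂ :=
  ∑ r ∈ Finset.range (min k l + 1),
    (cc d k l r : ℂ) * (x ^ (k - r) * (starRingEnd ℂ x) ^ (l - r))

/-- point of the real form -/
noncomputable def pt (x : Fin d → ℂ) : Fin d ⊕ Fin d → ℂ :=
  Sum.elim x (fun i => starRingEnd ℂ (x i))

lemma eval_sw (v : Fin d ⊕ Fin d → ℂ) (p : Poly d) : eval v (sw p) = eval (v ∘ Sum.swap) p := by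
  rw [sw, eval_rename]

lemma eval_pt_conj (x : Fin d → ℂ) (p : Poly d) :
    eval (pt x) (sw (cj p)) = starRingEnd ℂ (eval (pt x) p) := by
  induction p using MvPolynomial.induction_on with
  | C a => simp [cj, sw]
  | add p q hp hq => simp only [map_add, hp, hq]
  | mul_X p i hp =>
    simp only [map_mul, hp]
    rcases i with i | i <;> simp [cj, sw, pt]

/-- Existence of the orthonormal system of harmonics. -/
lemma exists_harm (hd : 2 ≤ d) (k l : ℕ) : ∃ h : Fin (mdim d k l) → Poly d,
    (∀ i, h i ∈ Harm d k l) ∧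
    (∀ i j, Bf (cj (h i)) (h j) = if i = j then 1 else 0) ∧
    (∀ p ∈ Harm d k l, p = ∑ i, Bf (cj (h i)) p • h i) := by
  rw [← finrank_Harm hd]
  exact exists_onb _

lemma kernel (hd : 2 ≤ d) {ι : Type*} [Fintype ι] {h : ι → Poly d} (h1 : ∀ i, h i ∈ Harm d k l)
    (h3 : ∀ p ∈ Harm d k l, p = ∑ i, Bf (cj (h i)) p • h i) (u v : Fin d ⊕ Fin d → ℂ) :
    (k.factorial * l.factorial : ℂ) * ∑ i, eval u (cj (h i)) * eval v (h i) =
      eval v (Zp u k l) := by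
  conv_rhs => rw [h3 _ (Zp_harm hd u k l)]
  simp only [map_sum, smul_eval, Finset.mul_sum]
  refine Finset.sum_congr rfl fun i _ => ?_
  rw [Bf_symm, Bf_Zp u (Harm_cj (h1 i))]
  ring

lemma kernel_pt (hd : 2 ≤ d) {ι : Type*} [Fintype ι] {h : ι → Poly d} (h1 : ∀ i, h i ∈ Harm d k l)
    (h3 : ∀ p ∈ Harm d k l, p = ∑ i, Bf (cj (h i)) p • h i) {x y : Fin d → ℂ}
    (hx : cInner x x = 1) (hy : cInner y y = 1) :
    (k.factorial * l.factorial : ℂ) *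
      ∑ i, starRingEnd ℂ (eval (pt x) (h i)) * eval (pt y) (h i) = gg d k l (cInner x y) := by
  have := kernel hd h1 h3 (pt x ∘ Sum.swap) (pt y)
  simp only [← eval_sw, eval_pt_conj] at this
  rw [this, Zp, map_sum, gg]
  have e1 : eval (pt x ∘ Sum.swap) Rr = 1 := by
    rw [eval_Rr, ← hx]; simp [pt, cInner]
  have e2 : eval (pt y) Rr = 1 := by
    rw [eval_Rr, ← hy]; simp [pt, cInner, mul_comm]
  have e3 : eval (pt y) (Al (pt x ∘ Sum.swap)) = cInner x y := by
    rw [eval_Al]; simp [pt, cInner]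
  have e4 : eval (pt y) (Ar (pt x ∘ Sum.swap)) = starRingEnd ℂ (cInner x y) := by
    rw [eval_Ar]; simp [pt, cInner]
  simp only [smul_eval, map_mul, map_pow, e1, e2, e3, e4, one_pow, mul_one, one_mul]

lemma gg_one (hd : 2 ≤ d) {ι : Type*} [Fintype ι] [DecidableEq ι] {h : ι → Poly d} (h1 : ∀ i, h i ∈ Harm d k l)
    (h2 : ∀ i j, Bf (cj (h i)) (h j) = if i = j then 1 else 0)
    (h3 : ∀ p ∈ Harm d k l, p = ∑ i, Bf (cj (h i)) p • h i) :
    gg d k l 1 = (k.factorial * l.factorial : ℂ) * (lam d k l * Fintype.card ι) := by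
  have key : (k.factorial * l.factorial : ℂ) • ∑ i, h i * sw (cj (h i)) =
      (gg d k l 1) • (Rr : Poly d) ^ (k + l) := by
    refine MvPolynomial.funext fun v => ?_
    have := kernel hd h1 h3 (v ∘ Sum.swap) v
    simp only [smul_eval, map_sum, map_mul, eval_sw, map_pow]
    simp only [mul_comm (eval v (h _))]
    rw [this, Zp, map_sum, gg, Finset.sum_mul]
    refine Finset.sum_congr rfl fun r hr => ?_
    have h1 : r ≤ min k l := Nat.lt_succ_iff.1 (Finset.mem_range.1 hr)
    have hk : r ≤ k := h1.trans (min_le_left _ _)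
    have hl : r ≤ l := h1.trans (min_le_right _ _)
    have e1 : eval (v ∘ Sum.swap) Rr = eval v Rr := by
      simp [eval_Rr, mul_comm]
    have e3 : eval v (Al (v ∘ Sum.swap)) = eval v Rr := by
      simp [eval_Al, eval_Rr, mul_comm]
    have e4 : eval v (Ar (v ∘ Sum.swap)) = eval v Rr := by
      simp [eval_Ar, eval_Rr]
    simp only [smul_eval, e1, e3, e4, map_mul, map_pow, one_pow, map_one, mul_one]
    obtain ⟨a, rfl⟩ := Nat.exists_eq_add_of_le hk
    obtain ⟨b, rfl⟩ := Nat.exists_eq_add_of_le hl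
    simp only [Nat.add_sub_cancel_left]
    ring
  have := congrArg Lf key
  rw [map_smul, map_smul, Lf_Rpow hd, map_sum] at this
  have hL : ∀ i, Lf (h i * sw (cj (h i))) = lam d k l := by
    intro i
    rw [claim hd k l _ (h1 i) l k _ (Harm_sw (Harm_cj (h1 i))), if_pos ⟨rfl, rfl⟩, sw_sw, Bf_symm,
      h2]
    simp
  simp only [hL, smul_eq_mul, mul_one, Finset.sum_const, Finset.card_univ, nsmul_eq_mul] at this
  rw [← this]; ring

end TD

namespace TD
open MvPolynomial
variable {d k l : ℕ}

lemma eval_pt_monomial (x : Fin d → ℂ) (s : Fin d ⊕ Fin d →₀ ℕ) :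
    eval (pt x) (monomial s 1) =
      (∏ i, (x i) ^ (s (Sum.inl i))) * ∏ i, ((starRingEnd ℂ) (x i)) ^ (s (Sum.inr i)) := by
  rw [eval_monomial, one_mul, Finsupp.prod_fintype _ _ (by simp), Fintype.prod_sum_type]
  rfl

/-- defect functional -/
noncomputable def Mf (X : Finset (Fin d → ℂ)) : Poly d →ₗ[ℂ] ℂ :=
  (∑ x ∈ X, (aeval (pt x) : Poly d →ₐ[ℂ] ℂ).toLinearMap) - (X.card : ℂ) • Lf

lemma Mf_apply (X : Finset (Fin d → ℂ)) (p : Poly d) :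
    Mf X p = (∑ x ∈ X, eval (pt x) p) - (X.card : ℂ) * Lf p := by
  simp [Mf, LinearMap.sum_apply, aeval_eq_eval]

lemma Mf_of_design {X : Finset (Fin d → ℂ)} {T : Finset (ℕ × ℕ)} (h : IsDesign d X T)
    {K L : ℕ} (hKL : (K, L) ∈ T) {p : Poly d} (hp : p ∈ Pol d K L) : Mf X p = 0 := by
  have := pol_ext (f := Mf X) (g := 0) (k := K) (l := L) ?_ hp
  · simpa using this
  intro s h1 h2
  rw [Mf_apply, Lf_monomial, one_mul, LinearMap.zero_apply, sub_eq_zero]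
  simp only [eval_pt_monomial]
  exact h _ hKL _ _ h1 h2

lemma design_of_Mf {X : Finset (Fin d → ℂ)} {T : Finset (ℕ × ℕ)}
    (h : ∀ kl ∈ T, ∀ s : Fin d ⊕ Fin d →₀ ℕ, ∑ i, s (Sum.inl i) = kl.1 → ∑ i, s (Sum.inr i) = kl.2 →
      Mf X (monomial s 1) = 0) : IsDesign d X T := by
  intro kl hkl a b ha hb
  have := h kl hkl (Finsupp.equivFunOnFinite.symm (Sum.elim a b)) (by simpa using ha)
    (by simpa using hb)
  rw [Mf_apply, Lf_monomial, one_mul, sub_eq_zero] at this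
  simp only [eval_pt_monomial] at this
  simpa using this

lemma eval_pt_Rr {x : Fin d → ℂ} (hx : cInner x x = 1) : eval (pt x) Rr = 1 := by
  rw [eval_Rr, ← hx]; simp [pt, cInner, mul_comm]

lemma Mf_Rr (hd : 2 ≤ d) {X : Finset (Fin d → ℂ)} (hX : ∀ x ∈ X, cInner x x = 1) {p : Poly d}
    (hp : p ∈ Pol d k l) : Mf X (Rr * p) = Mf X p := by
  rw [Mf_apply, Mf_apply, Lf_Rr hd hp]
  congr 1
  refine Finset.sum_congr rfl fun x hx => ?_
  rw [map_mul, eval_pt_Rr (hX x hx), one_mul]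

/-- orthonormal harmonics -/
noncomputable def hb (hd : 2 ≤ d) (k l : ℕ) : Fin (mdim d k l) → Poly d :=
  (exists_harm hd k l).choose

lemma hb_mem (hd : 2 ≤ d) (k l : ℕ) : ∀ i, hb hd k l i ∈ Harm d k l :=
  (exists_harm hd k l).choose_spec.1

lemma hb_orth (hd : 2 ≤ d) (k l : ℕ) :
    ∀ i j, Bf (cj (hb hd k l i)) (hb hd k l j) = if i = j then 1 else 0 :=
  (exists_harm hd k l).choose_spec.2.1

lemma hb_exp (hd : 2 ≤ d) (k l : ℕ) :
    ∀ p ∈ Harm d k l, p = ∑ i, Bf (cj (hb hd k l i)) p • hb hd k l i :=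
  (exists_harm hd k l).choose_spec.2.2

lemma hb_span (hd : 2 ≤ d) {p : Poly d} (hp : p ∈ Harm d k l) :
    p ∈ Submodule.span ℂ (Set.range (hb hd k l)) := by
  rw [hb_exp hd k l p hp]
  exact Submodule.sum_mem _ fun i _ => Submodule.smul_mem _ _ (Submodule.subset_span ⟨i, rfl⟩)

lemma hb_span' (hd : 2 ≤ d) {p : Poly d} (hp : p ∈ Harm d l k) :
    p ∈ Submodule.span ℂ (Set.range fun i => sw (cj (hb hd k l i))) := by
  have h1 := hb_exp hd k l _ (Harm_cj (Harm_sw hp))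
  have h2 := congrArg (fun q => sw (cj q)) h1
  simp only [cj_cj, sw_sw, map_sum, cj_smul, map_smul] at h2
  rw [h2]
  exact Submodule.sum_mem _ fun i _ => Submodule.smul_mem _ _ (Submodule.subset_span ⟨i, rfl⟩)

/-- index type -/
abbrev VV (d : ℕ) (S : Finset (ℕ × ℕ)) := Σ kl : S, Fin (mdim d kl.1.1 kl.1.2)

lemma card_VV (d : ℕ) (S : Finset (ℕ × ℕ)) : Fintype.card (VV d S) = ∑ kl ∈ S, mdim d kl.1 kl.2 := by
  rw [Fintype.card_sigma]
  simp only [Fintype.card_fin]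
  exact Finset.sum_coe_sort S (fun kl => mdim d kl.1 kl.2)

noncomputable def hv (hd : 2 ≤ d) (S : Finset (ℕ × ℕ)) (v : VV d S) : Poly d :=
  hb hd v.1.1.1 v.1.1.2 v.2

lemma Lf_hv (hd : 2 ≤ d) (S : Finset (ℕ × ℕ)) (v w : VV d S) :
    Lf (hv hd S v * sw (cj (hv hd S w))) =
      if v = w then (lam d v.1.1.1 v.1.1.2 : ℂ) else 0 := by
  obtain ⟨⟨⟨k, l⟩, h⟩, i⟩ := v
  obtain ⟨⟨⟨k', l'⟩, h'⟩, j⟩ := w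
  unfold hv
  rw [claim hd k l _ (hb_mem hd k l i) l' k' _ (Harm_sw (Harm_cj (hb_mem hd k' l' j)))]
  by_cases hk : k = k' ∧ l = l'
  · obtain ⟨rfl, rfl⟩ := hk
    rw [if_pos ⟨rfl, rfl⟩, sw_sw, Bf_symm, hb_orth]
    by_cases hij : i = j
    · subst hij; simp
    · rw [if_neg (Ne.symm hij), if_neg]
      · simp
      · simpa using hij
  · rw [if_neg hk, if_neg]
    intro h
    simp only [Sigma.mk.injEq, Subtype.mk.injEq, Prod.mk.injEq] at h
    exact hk h.1

noncomputable def uu (kl : ℕ × ℕ) (x : ℂ) : ℂ := x ^ kl.1 * (starRingEnd ℂ x) ^ kl.2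

lemma gg_split (d k l : ℕ) : gg d k l = uu (k, l) +
    ∑ r ∈ Finset.range (min k l), (cc d k l (r + 1)) • uu (k - (r + 1), l - (r + 1)) := by
  funext x
  simp only [gg, Finset.sum_range_succ', cc_zero, Pi.add_apply, Finset.sum_apply, Pi.smul_apply, uu,
    Complex.real_smul]
  simp [add_comm]

lemma uu_mem {S : Finset (ℕ × ℕ)} (hS : IsLowerSet' S) (d : ℕ) : ∀ k l, (k, l) ∈ S →
    uu (k, l) ∈ Submodule.span ℝ ((fun kl : ℕ × ℕ => gg d kl.1 kl.2) '' (S : Set (ℕ × ℕ))) := by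
  intro k
  induction k using Nat.strong_induction_on with
  | _ k ih =>
    intro l hkl
    have h := gg_split d k l
    rw [← sub_eq_iff_eq_add] at h
    rw [← h]
    refine Submodule.sub_mem _ (Submodule.subset_span ⟨(k, l), hkl, rfl⟩) ?_
    refine Submodule.sum_mem _ fun r hr => Submodule.smul_mem _ _ ?_
    have hr := Finset.mem_range.1 hr
    exact ih _ (by omega) _ (hS _ hkl _ (by simp) (by simp))

lemma gg_mem {S : Finset (ℕ × ℕ)} (hS : IsLowerSet' S) (d : ℕ) (k l : ℕ) (hkl : (k, l) ∈ S) :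
    gg d k l ∈ Submodule.span ℝ (uu '' (S : Set (ℕ × ℕ))) := by
  rw [gg_split]
  refine Submodule.add_mem _ (Submodule.subset_span ⟨(k, l), hkl, rfl⟩) ?_
  refine Submodule.sum_mem _ fun r hr => Submodule.smul_mem _ _ ?_
  exact Submodule.subset_span ⟨_, hS _ hkl _ (by simp) (by simp), rfl⟩

lemma uu_to_gg {S : Finset (ℕ × ℕ)} (hS : IsLowerSet' S) (d : ℕ) (c : ℕ × ℕ → ℝ) :
    ∃ f : ℕ × ℕ → ℝ, ∀ x, ∑ kl ∈ S, (f kl : ℂ) * gg d kl.1 kl.2 x = ∑ kl ∈ S, (c kl : ℂ) * uu kl x := by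
  have : ∑ kl ∈ S, c kl • uu kl ∈
      Submodule.span ℝ ((fun kl : ℕ × ℕ => gg d kl.1 kl.2) '' (S : Set (ℕ × ℕ))) :=
    Submodule.sum_mem _ fun kl h => Submodule.smul_mem _ _ (uu_mem hS d _ _ h)
  rw [Submodule.mem_span_image_finset_iff_exists_fun'] at this
  obtain ⟨f, hf⟩ := this
  refine ⟨f, fun x => ?_⟩
  have := congrFun hf x
  simpa [Finset.sum_apply] using this

lemma gg_to_uu {S : Finset (ℕ × ℕ)} (hS : IsLowerSet' S) (d : ℕ) (f : ℕ × ℕ → ℝ) :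
    ∃ c : ℕ × ℕ → ℝ, ∀ x, ∑ kl ∈ S, (c kl : ℂ) * uu kl x = ∑ kl ∈ S, (f kl : ℂ) * gg d kl.1 kl.2 x := by
  have : ∑ kl ∈ S, f kl • gg d kl.1 kl.2 ∈ Submodule.span ℝ (uu '' (S : Set (ℕ × ℕ))) :=
    Submodule.sum_mem _ fun kl h => Submodule.smul_mem _ _ (gg_mem hS d _ _ h)
  rw [Submodule.mem_span_image_finset_iff_exists_fun'] at this
  obtain ⟨f, hf⟩ := this
  refine ⟨f, fun x => ?_⟩
  have := congrFun hf x
  simpa [Finset.sum_apply] using this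

lemma kernel_sum (hd : 2 ≤ d) (S : Finset (ℕ × ℕ)) (f : ℕ × ℕ → ℂ) {x y : Fin d → ℂ}
    (hx : cInner x x = 1) (hy : cInner y y = 1) :
    ∑ v : VV d S, (f v.1.1 * (v.1.1.1.factorial * v.1.1.2.factorial)) *
      (starRingEnd ℂ (eval (pt x) (hv hd S v)) * eval (pt y) (hv hd S v)) =
    ∑ kl ∈ S, f kl * gg d kl.1 kl.2 (cInner x y) := by
  rw [Fintype.sum_sigma, ← Finset.sum_coe_sort S]
  refine Finset.sum_congr rfl fun kl _ => ?_
  rw [← kernel_pt hd (hb_mem hd kl.1.1 kl.1.2) (hb_exp hd kl.1.1 kl.1.2) hx hy, ← mul_assoc,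
    Finset.mul_sum]
  rfl

lemma split_sum (m n : ℕ) (a : Fin d → ℕ) (h : ∑ i, a i = m + n) :
    ∃ a1 a2 : Fin d → ℕ, (∀ i, a i = a1 i + a2 i) ∧ ∑ i, a1 i = m ∧ ∑ i, a2 i = n := by
  induction m generalizing n with
  | zero => exact ⟨0, a, by simp, by simp, by omega⟩
  | succ m ih =>
    obtain ⟨a1, a2, h1, h2, h3⟩ := ih (n + 1) (by omega)
    have : ∃ i, a2 i ≠ 0 := by
      by_contra hc
      push Not at hc
      simp [hc] at h3
    obtain ⟨i, hi⟩ := this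
    refine ⟨fun j => a1 j + if j = i then 1 else 0, fun j => a2 j - if j = i then 1 else 0, ?_, ?_, ?_⟩
    · intro j
      rw [h1]
      by_cases hj : j = i
      · subst hj; simp; omega
      · simp [hj]
    · simp [Finset.sum_add_distrib, h2]
    · have e : ∑ j, (a2 j - if j = i then 1 else 0) + ∑ j, (if j = i then 1 else 0) = ∑ j, a2 j := by
        rw [← Finset.sum_add_distrib]
        refine Finset.sum_congr rfl fun j _ => ?_
        by_cases hj : j = i
        · subst hj; simp; omega
        · simp [hj]
      simp only [Finset.sum_ite_eq', Finset.mem_univ, if_true] at e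
      show ∑ j, (a2 j - if j = i then 1 else 0) = n
      omega

lemma mono_mem (s : Fin d ⊕ Fin d →₀ ℕ) (h1 : ∑ i, s (Sum.inl i) = k) (h2 : ∑ i, s (Sum.inr i) = l) :
    (monomial s 1 : Poly d) ∈ Pol d k l := by
  rw [mem_Pol]
  exact ⟨isWeightedHomogeneous_monomial _ _ _ (by rw [weight_w1, h1]),
    isWeightedHomogeneous_monomial _ _ _ (by rw [weight_w2, h2])⟩

lemma design_of_hv (hd : 2 ≤ d) {X : Finset (Fin d → ℂ)} (hX : ∀ x ∈ X, cInner x x = 1)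
    {S : Finset (ℕ × ℕ)} (hS : IsLowerSet' S)
    (h : ∀ v w : VV d S, Mf X (hv hd S v * sw (cj (hv hd S w))) = 0) :
    IsDesign d X (convSet S S) := by
  have s1 : ∀ k l k' l', (k, l) ∈ S → (k', l') ∈ S → ∀ p ∈ Harm d k l, ∀ q ∈ Harm d l' k',
      Mf X (p * q) = 0 := by
    intro k l k' l' hk hk' p hp q hq
    refine Submodule.span_induction (p := fun p _ => Mf X (p * q) = 0) ?_ ?_ ?_ ?_ (hb_span hd hp)
    · rintro _ ⟨i, rfl⟩
      refine Submodule.span_induction (p := fun q _ => Mf X (hb hd k l i * q) = 0) ?_ ?_ ?_ ?_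
        (hb_span' hd hq)
      · rintro _ ⟨j, rfl⟩
        exact h ⟨⟨(k, l), hk⟩, i⟩ ⟨⟨(k', l'), hk'⟩, j⟩
      · simp
      · intro a b _ _ ha hb
        rw [mul_add, map_add, ha, hb, add_zero]
      · intro c a _ ha
        rw [mul_smul_comm, map_smul, ha, smul_zero]
    · simp
    · intro a b _ _ ha hb
      rw [add_mul, map_add, ha, hb, add_zero]
    · intro c a _ ha
      rw [smul_mul_assoc, map_smul, ha, smul_zero]
  have s2 : ∀ k l k' l', (k, l) ∈ S → (k', l') ∈ S → ∀ p ∈ Pol d k l, ∀ q ∈ Harm d l' k',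
      Mf X (p * q) = 0 := by
    intro k
    induction k with
    | zero =>
      intro l k' l' hk hk' p hp q hq
      exact s1 _ _ _ _ hk hk' _ (Harm_l0.ge hp) _ hq
    | succ k ih =>
      intro l k' l' hk hk' p hp q hq
      obtain _ | l := l
      · exact s1 _ _ _ _ hk hk' _ (Harm_r0.ge hp) _ hq
      · obtain ⟨a, ha, b, hb, rfl⟩ := decomp hd hp
        rw [add_mul, map_add, s1 _ _ _ _ hk hk' _ ha _ hq, mul_assoc, Mf_Rr hd hX (mul_mem hb hq.1),
          ih l k' l' (hS _ hk _ (by simp) (by simp)) hk' b hb q hq, add_zero]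
  have s3 : ∀ k' l' k l, (k, l) ∈ S → (k', l') ∈ S → ∀ p ∈ Pol d k l, ∀ q ∈ Pol d l' k',
      Mf X (p * q) = 0 := by
    intro k'
    induction k' with
    | zero =>
      intro l' k l hk hk' p hp q hq
      exact s2 _ _ _ _ hk hk' _ hp _ (Harm_r0.ge hq)
    | succ k' ih =>
      intro l' k l hk hk' p hp q hq
      obtain _ | l' := l'
      · exact s2 _ _ _ _ hk hk' _ hp _ (Harm_l0.ge hq)
      · obtain ⟨a, ha, b, hb, rfl⟩ := decomp hd hq
        rw [mul_add, map_add, s2 _ _ _ _ hk hk' _ hp _ ha, mul_left_comm, Mf_Rr hd hX (mul_mem hp hb),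
          ih l' k l hk (hS _ hk' _ (by simp) (by simp)) p hp b hb, add_zero]
  refine design_of_Mf ?_
  intro kl hkl s h1 h2
  simp only [convSet, Finset.mem_image, Finset.mem_product, Prod.exists] at hkl
  obtain ⟨k, l, k', l', ⟨hk, hk'⟩, rfl⟩ := hkl
  obtain ⟨a1, a2, ha, ha1, ha2⟩ := split_sum k l' _ h1
  obtain ⟨b2, b1, hb, hb2, hb1⟩ := split_sum k' l _ h2
  have e : (monomial s 1 : Poly d) = monomial (Finsupp.equivFunOnFinite.symm (Sum.elim a1 b1)) 1 *
      monomial (Finsupp.equivFunOnFinite.symm (Sum.elim a2 b2)) 1 := by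
    rw [monomial_mul, one_mul]
    refine congrArg (fun t => monomial t (1 : ℂ)) (Finsupp.ext fun i => ?_)
    rcases i with i | i
    · simp [ha]
    · simp [hb, add_comm]
  rw [e]
  exact s3 k' l' k l hk hk' _ (mono_mem _ (by simpa using ha1) (by simpa using hb1)) _
    (mono_mem _ (by simpa using ha2) (by simpa using hb2))

lemma Mf_hv (hd : 2 ≤ d) (X : Finset (Fin d → ℂ)) (S : Finset (ℕ × ℕ)) (v w : VV d S) :
    Mf X (hv hd S v * sw (cj (hv hd S w))) =
      (∑ x : X, eval (pt x.1) (hv hd S v) * starRingEnd ℂ (eval (pt x.1) (hv hd S w))) -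
      X.card * if v = w then (lam d v.1.1.1 v.1.1.2 : ℂ) else 0 := by
  rw [Mf_apply, Lf_hv, ← Finset.sum_coe_sort X]
  simp only [map_mul, eval_pt_conj]

lemma hv_of_design (hd : 2 ≤ d) {X : Finset (Fin d → ℂ)} {S : Finset (ℕ × ℕ)}
    (h : IsDesign d X (convSet S S)) (v w : VV d S) :
    Mf X (hv hd S v * sw (cj (hv hd S w))) = 0 := by
  have h1 := mul_mem (hb_mem hd _ _ v.2).1 (Harm_sw (Harm_cj (hb_mem hd _ _ w.2))).1
  refine Mf_of_design h ?_ h1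
  simp only [convSet, Finset.mem_image, Finset.mem_product]
  exact ⟨(v.1.1, w.1.1), ⟨v.1.2, w.1.2⟩, by simp [add_comm]⟩

/-- matrices attached to a design -/
lemma design_matrix (hd : 2 ≤ d) {X : Finset (Fin d → ℂ)} (hne : X.Nonempty) {S : Finset (ℕ × ℕ)}
    (h : IsDesign d X (convSet S S)) :
    (Matrix.of fun (v : VV d S) (x : X) => eval (pt x.1) (hv hd S v)) *
      (Matrix.of fun (x : X) (v : VV d S) => starRingEnd ℂ (eval (pt x.1) (hv hd S v)) *
        (X.card * lam d v.1.1.1 v.1.1.2 : ℂ)⁻¹) = 1 := by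
  ext v w
  have := hv_of_design hd h v w
  rw [Mf_hv, sub_eq_zero] at this
  simp only [Matrix.mul_apply, Matrix.of_apply, ← mul_assoc, ← Finset.sum_mul]
  rw [this, Matrix.one_apply]
  have h1 : (X.card : ℂ) ≠ 0 := by simpa using hne.ne_empty
  have h2 : (lam d w.1.1.1 w.1.1.2 : ℂ) ≠ 0 := by exact_mod_cast lam_pos.ne'
  split_ifs with hvw
  · subst hvw
    field_simp
  · simp

open scoped Classical in
lemma code_matrix (hd : 2 ≤ d) {X : Finset (Fin d → ℂ)} (hX : ∀ x ∈ X, cInner x x = 1)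
    {S : Finset (ℕ × ℕ)} (hS : IsLowerSet' S) (h : IsCode d X S) :
    ∃ D : ℕ × ℕ → ℂ,
    (Matrix.of fun (x : X) (v : VV d S) => starRingEnd ℂ (eval (pt x.1) (hv hd S v))) *
    (Matrix.of fun (v : VV d S) (x : X) => D v.1.1 * eval (pt x.1) (hv hd S v)) = 1 := by
  obtain ⟨c, h0, h1⟩ := h
  obtain ⟨f, hf⟩ := uu_to_gg hS d c
  have hc : ((∑ kl ∈ S, c kl : ℝ) : ℂ) ≠ 0 := by exact_mod_cast h1.ne'
  refine ⟨fun kl => ((∑ kl ∈ S, c kl : ℝ) : ℂ)⁻¹ * (f kl * (kl.1.factorial * kl.2.factorial)), ?_⟩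
  ext x y
  have := kernel_sum hd S (fun kl => (f kl : ℂ)) (hX x x.2) (hX y y.2)
  rw [hf] at this
  simp only [Matrix.mul_apply, Matrix.of_apply]
  calc _ = ((∑ kl ∈ S, c kl : ℝ) : ℂ)⁻¹ * ∑ v : VV d S,
      (f v.1.1 * (v.1.1.1.factorial * v.1.1.2.factorial)) *
      (starRingEnd ℂ (eval (pt x.1) (hv hd S v)) * eval (pt y.1) (hv hd S v)) := by
        rw [Finset.mul_sum]
        exact Finset.sum_congr rfl fun _ _ => by ring
    _ = _ := by
        rw [this, Matrix.one_apply]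
        split_ifs with hxy
        · subst hxy
          rw [hX x x.2]
          simp only [uu, one_pow, map_one, mul_one]
          rw [← Complex.ofReal_sum, inv_mul_cancel₀ hc]
        · have hmem : cInner x.1 y.1 ∈ innerSet X := by
            simp only [innerSet, Finset.mem_image, Finset.mem_filter, Finset.mem_product]
            exact ⟨(x.1, y.1), ⟨⟨x.2, y.2⟩, fun h => hxy (Subtype.ext h)⟩, rfl⟩
          have := h0 _ hmem
          simp only [uu, ← mul_assoc]
          rw [this, mul_zero]

lemma card_le_of_mul {m n : Type*} [Fintype m] [Fintype n] [DecidableEq m] {A : Matrix m n ℂ}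
    {B : Matrix n m ℂ} (h : A * B = 1) : Fintype.card m ≤ Fintype.card n := by
  have h1 := Matrix.rank_mul_le_left A B
  rw [h, Matrix.rank_one] at h1
  exact h1.trans (Matrix.rank_le_card_width A)

open scoped Classical in
lemma card_of (hd : 2 ≤ d) {X : Finset (Fin d → ℂ)} (hne : X.Nonempty)
    (hX : ∀ x ∈ X, cInner x x = 1)
    {S : Finset (ℕ × ℕ)} (hS : IsLowerSet' S) (h : IsCode d X S) (h' : IsDesign d X (convSet S S)) :
    X.card = ∑ kl ∈ S, mdim d kl.1 kl.2 := by
  obtain ⟨D, hD⟩ := code_matrix hd hX hS h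
  have h1 := card_le_of_mul hD
  have h2 := card_le_of_mul (design_matrix hd hne h')
  rw [card_VV, Fintype.card_coe] at h1 h2
  omega

open scoped Classical in
lemma design_of (hd : 2 ≤ d) {X : Finset (Fin d → ℂ)}
    (hX : ∀ x ∈ X, cInner x x = 1)
    {S : Finset (ℕ × ℕ)} (hS : IsLowerSet' S) (h : IsCode d X S)
    (hcard : X.card = ∑ kl ∈ S, mdim d kl.1 kl.2) : IsDesign d X (convSet S S) := by
  obtain ⟨D, hD⟩ := code_matrix hd hX hS h
  have hc : Fintype.card X = Fintype.card (VV d S) := by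
    rw [card_VV, Fintype.card_coe, hcard]
  replace hD := (Matrix.mul_eq_one_comm_of_card_eq (R := ℂ) (eq := hc)).1 hD
  have hD' : ∀ v w : VV d S, D v.1.1 * ∑ x : X, eval (pt x.1) (hv hd S v) *
      starRingEnd ℂ (eval (pt x.1) (hv hd S w)) = if v = w then 1 else 0 := by
    intro v w
    have := congrFun (congrFun hD v) w
    simp only [Matrix.mul_apply, Matrix.of_apply, Matrix.one_apply, mul_assoc, ← Finset.mul_sum]
      at this
    exact this
  refine design_of_hv hd hX hS fun v w => ?_
  rw [Mf_hv]
  -- the constant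
  have hDv : D v.1.1 * (X.card * lam d v.1.1.1 v.1.1.2) = 1 := by
    obtain ⟨⟨⟨k, l⟩, hkl⟩, i⟩ := v
    have e1 : ∀ j : Fin (mdim d k l), D (k, l) * ∑ x : X, eval (pt x.1) (hb hd k l j) *
      starRingEnd ℂ (eval (pt x.1) (hb hd k l j)) = 1 := by
      intro j
      have := hD' ⟨⟨(k, l), hkl⟩, j⟩ ⟨⟨(k, l), hkl⟩, j⟩
      rw [if_pos rfl] at this
      exact this
    have e2 : ∑ j : Fin (mdim d k l), D (k, l) * ∑ x : X, eval (pt x.1) (hb hd k l j) *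
      starRingEnd ℂ (eval (pt x.1) (hb hd k l j)) = mdim d k l := by
      simp only [e1]; simp
    rw [← Finset.mul_sum, Finset.sum_comm] at e2
    have hf : (k.factorial * l.factorial : ℂ) ≠ 0 := by
      exact_mod_cast mul_ne_zero (Nat.factorial_ne_zero k) (Nat.factorial_ne_zero l)
    have e3 : ∀ x : X, ∑ j, eval (pt x.1) (hb hd k l j) *
      starRingEnd ℂ (eval (pt x.1) (hb hd k l j)) = lam d k l * mdim d k l := by
      intro x
      have a1 := kernel_pt hd (hb_mem hd k l) (hb_exp hd k l) (hX x x.2) (hX x x.2)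
      rw [hX x x.2, gg_one hd (hb_mem hd k l) (hb_orth hd k l) (hb_exp hd k l)] at a1
      have a2 := mul_left_cancel₀ hf a1
      rw [Fintype.card_fin] at a2
      rw [← a2]
      exact Finset.sum_congr rfl fun _ _ => mul_comm _ _
    simp only [e3, Finset.sum_const, Finset.card_univ, Fintype.card_coe, nsmul_eq_mul] at e2
    have hm : (mdim d k l : ℂ) ≠ 0 := by
      have : 0 < mdim d k l := i.pos
      exact_mod_cast this.ne'
    refine mul_right_cancel₀ hm ?_
    rw [one_mul]
    refine Eq.trans ?_ e2
    simp only [mul_assoc]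
  have hD0 : D v.1.1 ≠ 0 := left_ne_zero_of_mul_eq_one hDv
  refine mul_left_cancel₀ hD0 ?_
  rw [mul_sub, hD', mul_zero]
  split_ifs with hvw
  · rw [hDv, sub_self]
  · simp

open scoped Classical in
lemma code_of (hd : 2 ≤ d) {X : Finset (Fin d → ℂ)} (hne : X.Nonempty)
    (hX : ∀ x ∈ X, cInner x x = 1)
    {S : Finset (ℕ × ℕ)} (hS : IsLowerSet' S) (h : IsDesign d X (convSet S S))
    (hcard : X.card = ∑ kl ∈ S, mdim d kl.1 kl.2) : IsCode d X S := by
  have hD := design_matrix hd hne h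
  have hc : Fintype.card (VV d S) = Fintype.card X := by
    rw [card_VV, Fintype.card_coe, hcard]
  replace hD := (Matrix.mul_eq_one_comm_of_card_eq (R := ℂ) (eq := hc)).1 hD
  have hX0 : (X.card : ℂ) ≠ 0 := by simpa using hne.ne_empty
  obtain ⟨c, hc⟩ := gg_to_uu hS d
    (fun kl => (lam d kl.1 kl.2)⁻¹ * (kl.1.factorial * kl.2.factorial : ℝ)⁻¹)
  have key : ∀ x y : X, ∑ kl ∈ S, (c kl : ℂ) * uu kl (cInner x.1 y.1) =
      if x = y then (X.card : ℂ) else 0 := by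
    intro x y
    rw [hc, ← kernel_sum hd S _ (hX x x.2) (hX y y.2)]
    have := congrFun (congrFun hD x) y
    simp only [Matrix.mul_apply, Matrix.of_apply, Matrix.one_apply] at this
    have e := congrArg (fun z => (X.card : ℂ) * z) this
    simp only [mul_ite, mul_one, mul_zero] at e
    rw [← e, Finset.mul_sum]
    refine Finset.sum_congr rfl fun v _ => ?_
    have h2 : (lam d v.1.1.1 v.1.1.2 : ℂ) ≠ 0 := by exact_mod_cast lam_pos.ne'
    have h3 : (v.1.1.1.factorial : ℂ) ≠ 0 := by exact_mod_cast Nat.factorial_ne_zero _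
    have h4 : (v.1.1.2.factorial : ℂ) ≠ 0 := by exact_mod_cast Nat.factorial_ne_zero _
    push_cast
    field_simp
  refine ⟨c, ?_, ?_⟩
  · intro α hα
    simp only [innerSet, Finset.mem_image, Finset.mem_filter, Finset.mem_product] at hα
    obtain ⟨⟨x, y⟩, ⟨⟨hx, hy⟩, hxy⟩, rfl⟩ := hα
    have := key ⟨x, hx⟩ ⟨y, hy⟩
    rw [if_neg (fun h => hxy (congrArg Subtype.val h))] at this
    simp only [uu, ← mul_assoc] at this
    exact this
  · obtain ⟨x, hx⟩ := hne
    have := key ⟨x, hx⟩ ⟨x, hx⟩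
    rw [if_pos rfl, hX x hx] at this
    simp only [uu, one_pow, map_one, mul_one] at this
    have h2 : ∑ kl ∈ S, c kl = (X.card : ℝ) := by exact_mod_cast this
    rw [h2]
    exact_mod_cast Finset.card_pos.2 ⟨x, hx⟩

end TD

open scoped Classical

/-- equivalence of tightness: (i) `X` is an `S`-code and an
`S*S`-design ↔ (ii) `X` is a tight `S`-code ↔ (iii) `X` is a tight design with
respect to `S`. -/
theorem stmt_13 {d : ℕ} (hd : 2 ≤ d) (X : Finset (Fin d → ℂ)) (hXne : X.Nonempty)
    (hXsphere : ∀ x ∈ X, cInner x x = 1) (S : Finset (ℕ × ℕ)) (hS : IsLowerSet' S) :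
    ((IsCode d X S ∧ IsDesign d X (convSet S S)) ↔
      (IsCode d X S ∧ X.card = ∑ kl ∈ S, mdim d kl.1 kl.2)) ∧
    ((IsCode d X S ∧ X.card = ∑ kl ∈ S, mdim d kl.1 kl.2) ↔
      (IsDesign d X (convSet S S) ∧ X.card = ∑ kl ∈ S, mdim d kl.1 kl.2)) := by
  have h1 := TD.card_of (S := S) hd hXne hXsphere hS
  have h2 := TD.design_of (S := S) hd hXsphere hS
  have h3 := TD.code_of (S := S) hd hXne hXsphere hS
  refine ⟨⟨fun h => ⟨h.1, h1 h.1 h.2⟩, fun h => ⟨h.1, h2 h.1 h.2⟩⟩,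
    ⟨fun h => ⟨h2 h.1 h.2, h.2⟩, fun h => ⟨h3 h.1 h.2, h.2⟩⟩⟩
end

section
/- Let d ≥ 2, let 𝒰 be a lower set, and let X ⊆ Ω(d) be a complex spherical 𝒰*𝒰-design whose inner product set A(X) has cardinality s, and suppose |𝒰| = s+1. Then every α ∈ A(X) satisfies Σ_{(k,l)∈𝒰} g_{k,l}(α) = 0. -/
open Finset

open scoped Classical

theorem aux_alt_succ (k : ℕ) (f : ℕ → ℂ) :
    ∑ r ∈ range (k + 1 + 1), (-1 : ℂ) ^ r * ((k + 1).choose r : ℂ) * f r =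
      ∑ r ∈ range (k + 1), (-1 : ℂ) ^ r * (k.choose r : ℂ) * (f r - f (r + 1)) := by
  rw [Finset.sum_range_succ']
  have h1 : ∀ r, (-1 : ℂ) ^ (r + 1) * ((k + 1).choose (r + 1) : ℂ) * f (r + 1) =
      (-1 : ℂ) ^ (r + 1) * (k.choose (r + 1) : ℂ) * f (r + 1) -
        (-1 : ℂ) ^ r * (k.choose r : ℂ) * f (r + 1) := by
    intro r
    rw [Nat.choose_succ_succ]; push_cast; ring
  simp only [h1, mul_sub, Finset.sum_sub_distrib]
  have h2 := Finset.sum_range_succ' (fun r => (-1 : ℂ) ^ r * (k.choose r : ℂ) * f r) (k + 1)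
  rw [Finset.sum_range_succ] at h2
  simp at h2
  simp only [Nat.choose_zero_right] at *
  rw [h2]; simp; ring

theorem aux_choose (k : ℕ) : ∀ n m : ℕ,
    ∑ r ∈ range (k + 1), (-1 : ℂ) ^ r * (k.choose r : ℂ) * ((n + k - r).choose (m + k) : ℂ) =
      (n.choose m : ℂ) := by
  induction k with
  | zero => intro n m; simp
  | succ k ih =>
    intro n m
    rw [aux_alt_succ, ← ih n m]
    refine Finset.sum_congr rfl fun r hr => ?_
    have hr' : r ≤ k := by simpa [Nat.lt_succ_iff] using hr
    congr 1
    have e1 : n + (k + 1) - r = (n + k - r) + 1 := by omega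
    have e2 : n + (k + 1) - (r + 1) = n + k - r := by omega
    rw [e1, e2, show m + (k + 1) = (m + k) + 1 by ring, Nat.choose_succ_succ]
    push_cast; ring

theorem aux_beta (k : ℕ) : ∀ M : ℕ,
    ∑ r ∈ range (k + 1), (-1 : ℂ) ^ r * (k.choose r : ℂ) * (((M + k + 1 : ℕ) : ℂ) - r)⁻¹ =
      (-1) ^ k * (k.factorial : ℂ) * (M.factorial : ℂ) / ((M + k + 1).factorial : ℂ) := by
  induction k with
  | zero =>
    intro M
    have : ((M.factorial : ℕ) : ℂ) ≠ 0 := by exact_mod_cast M.factorial_ne_zero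
    have h2 : (M : ℂ) + 1 ≠ 0 := by exact_mod_cast M.succ_ne_zero
    simp [Nat.factorial_succ]; field_simp
  | succ k ih =>
    intro M
    rw [aux_alt_succ]
    simp only [mul_sub, Finset.sum_sub_distrib]
    have h1 := ih (M + 1)
    have h2 := ih M
    have e1 : M + (k + 1) + 1 = M + 1 + k + 1 := by ring
    rw [e1, h1]
    have e2 : ∀ r : ℕ, ((M + 1 + k + 1 : ℕ) : ℂ) - ((r + 1 : ℕ) : ℂ) = ((M + k + 1 : ℕ) : ℂ) - r := by
      intro r; push_cast; ring
    simp only [e2]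
    rw [h2, show M + 1 + k + 1 = (M + k + 1) + 1 by ring, Nat.factorial_succ (M + k + 1),
      Nat.factorial_succ M, Nat.factorial_succ k]
    have : (((M + k + 1).factorial : ℕ) : ℂ) ≠ 0 := by exact_mod_cast Nat.factorial_ne_zero _
    have h2 : ((M + k + 1 + 1 : ℕ) : ℂ) ≠ 0 := by exact_mod_cast (M + k + 1).succ_ne_zero
    push_cast at *
    field_simp
    ring

theorem aux_poly (p : Polynomial ℂ) (k : ℕ) (h : p.natDegree < k) :
    ∑ r ∈ range (k + 1), (-1 : ℂ) ^ r * (k.choose r : ℂ) * p.eval (r : ℂ) = 0 := by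
  have h1 := congrFun (Polynomial.fwdDiff_iter_eq_zero_of_degree_lt h) 0
  rw [fwdDiff_iter_eq_sum_shift] at h1
  have h2 : ∑ r ∈ range (k + 1), (-1 : ℂ) ^ r * (k.choose r : ℂ) * p.eval (r : ℂ) =
      (-1) ^ k * ∑ r ∈ range (k + 1), ((-1 : ℤ) ^ (k - r) * k.choose r) • p.eval (0 + r • (1 : ℂ)) := by
    rw [Finset.mul_sum]
    refine Finset.sum_congr rfl fun r hr => ?_
    have hr' : r ≤ k := by simpa [Nat.lt_succ_iff] using hr
    simp only [zsmul_eq_mul]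
    push_cast
    have : (-1 : ℂ) ^ k * (-1) ^ (k - r) = (-1) ^ r := by
      rw [← pow_add]
      obtain ⟨m, rfl⟩ := Nat.exists_eq_add_of_le hr'
      rw [show r + m + (r + m - r) = r + 2 * m by omega, pow_add, pow_mul]; simp
    rw [← this]; simp; ring
  rw [h2, h1]; simp

theorem aux_lin_natDegree (n : ℕ) (c : ℂ) :
    ((descPochhammer ℂ n).comp (Polynomial.C c - Polynomial.X)).natDegree ≤ n := by
  refine Polynomial.natDegree_comp_le.trans ?_
  rw [descPochhammer_natDegree]
  have : (Polynomial.C c - Polynomial.X : Polynomial ℂ).natDegree ≤ 1 := by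
    compute_degree
  nlinarith

theorem aux_lin_eval (n c r : ℕ) (h : r ≤ c) :
    ((descPochhammer ℂ n).comp (Polynomial.C (c : ℂ) - Polynomial.X)).eval (r : ℂ) =
      ((c - r).descFactorial n : ℂ) := by
  rw [Polynomial.eval_comp, ← descPochhammer_eval_eq_descFactorial, Nat.cast_sub h]
  simp

/-- vanishing of lower moments -/
theorem aux_S_pos (D k l j : ℕ) (hj : 1 ≤ j) (hk : j ≤ k) (hl : j ≤ l) :
    ∑ r ∈ range (k + 1), (-1 : ℂ) ^ r * (k.choose r : ℂ) *
      (((D + k + l - r).descFactorial (j - 1) : ℂ) * ((k + l - j - r).descFactorial (k - j) : ℂ)) = 0 := by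
  rw [← aux_poly ((descPochhammer ℂ (j - 1)).comp (Polynomial.C ((D + k + l : ℕ) : ℂ) - Polynomial.X) *
    (descPochhammer ℂ (k - j)).comp (Polynomial.C ((k + l - j : ℕ) : ℂ) - Polynomial.X)) k ?_]
  · refine Finset.sum_congr rfl fun r hr => ?_
    have hr' : r ≤ k := by simpa [Nat.lt_succ_iff] using hr
    rw [Polynomial.eval_mul, aux_lin_eval _ _ _ (by omega), aux_lin_eval _ _ _ (by omega)]
  · refine lt_of_le_of_lt Polynomial.natDegree_mul_le ?_
    have h1 := aux_lin_natDegree (j - 1) ((D + k + l : ℕ) : ℂ)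
    have h2 := aux_lin_natDegree (k - j) ((k + l - j : ℕ) : ℂ)
    omega

theorem aux_S_zero (D k l : ℕ) :
    ∑ r ∈ range (k + 1), (-1 : ℂ) ^ r * (k.choose r : ℂ) *
      (((k + l - r).descFactorial k : ℂ) * (((D + l + k + 1 : ℕ) : ℂ) - r)⁻¹) =
      (k.factorial : ℂ) * ((D + k).factorial : ℂ) * ((D + l).factorial : ℂ) /
        ((D.factorial : ℂ) * ((D + l + k + 1).factorial : ℂ)) := by
  set N : ℂ := ((D + l + k + 1 : ℕ) : ℂ) with hN
  set p := (descPochhammer ℂ k).comp (Polynomial.C ((k + l : ℕ) : ℂ) - Polynomial.X) with hp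
  have hpdeg : p.natDegree ≤ k := aux_lin_natDegree _ _
  set q := p /ₘ (Polynomial.X - Polynomial.C N) with hq
  have hpq : Polynomial.C (p.eval N) + (Polynomial.X - Polynomial.C N) * q = p := by
    rw [← Polynomial.modByMonic_X_sub_C_eq_C_eval]; exact Polynomial.modByMonic_add_div p (Polynomial.X - Polynomial.C N)
  have hqs : ∑ r ∈ range (k + 1), (-1 : ℂ) ^ r * (k.choose r : ℂ) * q.eval (r : ℂ) = 0 := by
    rcases Nat.eq_zero_or_pos k with h0 | h0
    · have : q = 0 := by
        rw [hq, Polynomial.divByMonic_eq_zero_iff (Polynomial.monic_X_sub_C _), Polynomial.degree_X_sub_C]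
        refine lt_of_le_of_lt Polynomial.degree_le_natDegree ?_
        have : p.natDegree = 0 := by omega
        rw [this]; norm_num
      rw [this]; simp
    · apply aux_poly
      rw [hq, Polynomial.natDegree_divByMonic _ (Polynomial.monic_X_sub_C _), Polynomial.natDegree_X_sub_C]
      omega
  have hpN : p.eval N = (-1) ^ k * ((D + k).factorial : ℂ) / (D.factorial : ℂ) := by
    rw [hp, Polynomial.eval_comp]
    have e : Polynomial.eval N (Polynomial.C ((k + l : ℕ) : ℂ) - Polynomial.X) = -((D + 1 : ℕ) : ℂ) := by
      simp [hN]; ring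
    have h1 := ascPochhammer_eval_neg_eq_descPochhammer ℂ (-((D + 1 : ℕ) : ℂ)) k
    rw [neg_neg] at h1
    have h2 := factorial_mul_ascPochhammer ℂ D k
    rw [e]
    push_cast at h1 h2 ⊢
    rw [← h2, h1]
    have : (D.factorial : ℂ) ≠ 0 := by exact_mod_cast Nat.factorial_ne_zero _
    have h3 : ((-1 : ℂ) ^ k) * (-1) ^ k = 1 := by rw [← mul_pow]; simp
    field_simp
    linear_combination (-(Polynomial.eval (-((D : ℂ) + 1)) (descPochhammer ℂ k))) * h3
  have hterm : ∀ r ∈ range (k + 1), (-1 : ℂ) ^ r * (k.choose r : ℂ) *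
      (((k + l - r).descFactorial k : ℂ) * (N - r)⁻¹) =
      p.eval N * ((-1 : ℂ) ^ r * (k.choose r : ℂ) * (N - r)⁻¹) -
        (-1 : ℂ) ^ r * (k.choose r : ℂ) * q.eval (r : ℂ) := by
    intro r hr
    have hr' : r ≤ k := by simpa [Nat.lt_succ_iff] using hr
    rw [← aux_lin_eval _ _ _ (by omega), ← hp]
    have h1 : p.eval (r : ℂ) = p.eval N + (r - N) * q.eval (r : ℂ) := by
      conv_lhs => rw [← hpq]
      simp
    have hne : N - r ≠ 0 := by
      rw [hN, ← Nat.cast_sub (by omega)]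
      exact_mod_cast (by omega)
    rw [h1]; field_simp; ring
  rw [Finset.sum_congr rfl hterm, Finset.sum_sub_distrib, hqs, ← Finset.mul_sum, hN,
    aux_beta k (D + l), ← hN, hpN]
  have h3 : ((-1 : ℂ) ^ k) * (-1) ^ k = 1 := by rw [← mul_pow]; simp
  have : (D.factorial : ℂ) ≠ 0 := by exact_mod_cast Nat.factorial_ne_zero _
  have : ((D + l + k + 1).factorial : ℂ) ≠ 0 := by exact_mod_cast Nat.factorial_ne_zero _
  field_simp
  linear_combination ((D + k).factorial : ℂ) * (k.factorial : ℂ) * ((D + l).factorial : ℂ) * h3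

/-- moments of the projected measure -/
noncomputable def auxMom (d a b : ℕ) : ℂ :=
  if a = b then ((d - 1).factorial : ℂ) * (a.factorial : ℂ) / ((d + a - 1).factorial : ℂ) else 0

/-- coefficients of the Jacobi polynomials -/
noncomputable def auxJc (d k l r : ℕ) : ℂ :=
  (((d + k + l - 1 : ℕ) : ℂ) / ((d - 1).factorial : ℂ)) *
    (((-1 : ℂ) ^ r * ((d + k + l - r - 2).factorial : ℂ)) /
          ((r.factorial : ℂ) * ((k - r).factorial : ℂ) * ((l - r).factorial : ℂ)))

theorem aux_jacobi_eq (d k l : ℕ) (x : ℂ) :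
    jacobi d k l x = ∑ r ∈ range (min k l + 1),
      auxJc d k l r * (x ^ (k - r) * ((starRingEnd ℂ) x) ^ (l - r)) := by
  unfold jacobi auxJc
  rw [Finset.mul_sum]
  refine Finset.sum_congr rfl fun r _ => ?_
  ring

theorem aux_extend (k l : ℕ) (f h : ℕ → ℂ) (h1 : ∀ r, r ≤ k → r ≤ l → f r = h r)
    (h2 : ∀ r, r ≤ k → l < r → h r = 0) :
    ∑ r ∈ range (min k l + 1), f r = ∑ r ∈ range (k + 1), h r := by
  rw [Finset.sum_congr rfl (g := h)]
  · apply Finset.sum_subset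
    · intro r; simp; omega
    · intro r hr hr'
      simp at hr hr'
      exact h2 r (by omega) (by omega)
  · intro r hr
    simp at hr
    exact h1 r (by omega) (by omega)

theorem aux_fne (n : ℕ) : (n.factorial : ℂ) ≠ 0 := by exact_mod_cast n.factorial_ne_zero

theorem aux_choose_cast (k r : ℕ) (h : r ≤ k) :
    (k.choose r : ℂ) * (r.factorial : ℂ) * ((k - r).factorial : ℂ) = (k.factorial : ℂ) := by
  exact_mod_cast Nat.choose_mul_factorial_mul_factorial h

theorem aux_desc_cast (n k m : ℕ) (h : n = k + m) :
    (m.factorial : ℂ) * (n.descFactorial k : ℂ) = (n.factorial : ℂ) := by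
  subst h
  have := Nat.factorial_mul_descFactorial (n := k + m) (k := k) (by omega)
  rw [Nat.add_sub_cancel_left] at this
  exact_mod_cast this

theorem aux_jacobi_one (D k l : ℕ) :
    jacobi (D + 2) k l 1 = ((D + k + l + 1 : ℕ) : ℂ) * ((D + k).factorial : ℂ) *
      ((D + l).factorial : ℂ) / ((k.factorial : ℂ) * (l.factorial : ℂ) * (D.factorial : ℂ) *
        ((D + 1).factorial : ℂ)) := by
  rw [aux_jacobi_eq]
  rw [aux_extend k l _ (fun r => (((D + k + l + 1 : ℕ) : ℂ) * ((D + k).factorial : ℂ) /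
      (((D + 1).factorial : ℂ) * (k.factorial : ℂ))) *
      ((-1 : ℂ) ^ r * (k.choose r : ℂ) * ((D + l + k - r).choose (D + k) : ℂ)))]
  · rw [← Finset.mul_sum, aux_choose]
    have h := aux_choose_cast (D + l) D (by omega)
    rw [Nat.add_sub_cancel_left] at h
    rw [← h]
    have := aux_fne D
    have := aux_fne l
    have := aux_fne k
    have := aux_fne (D + 1)
    field_simp
  · intro r hk hl
    unfold auxJc
    have h1 := aux_choose_cast k r hk
    have h2 := aux_choose_cast (D + l + k - r) (D + k) (by omega)
    rw [show D + l + k - r - (D + k) = l - r by omega] at h2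
    rw [show D + 2 + k + l - 1 = D + k + l + 1 by omega,
      show D + 2 + k + l - r - 2 = D + l + k - r by omega, show D + 2 - 1 = D + 1 by omega,
      ← h1, ← h2]
    have := aux_fne r
    have := aux_fne (k - r)
    have := aux_fne (l - r)
    have := aux_fne (D + 1)
    have hc : (k.choose r : ℂ) ≠ 0 := by exact_mod_cast (Nat.choose_pos hk).ne'
    simp
    field_simp
  · intro r hk hl
    rw [Nat.choose_eq_zero_of_lt (by omega : D + l + k - r < D + k)]
    simp

theorem aux_A0 (D k l a b : ℕ) (ha : a ≤ k) (hb : b ≤ l) (hne : ¬ (a = k ∧ b = l)) :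
    ∑ r ∈ range (min k l + 1),
      auxJc (D + 2) k l r * auxMom (D + 2) (k - r + b) (l - r + a) = 0 := by
  by_cases hdiag : k + b = l + a
  · obtain ⟨j, rfl⟩ := Nat.exists_eq_add_of_le ha
    have hbl : l = b + j := by omega
    subst hbl
    have hj : 1 ≤ j := by omega
    rw [aux_extend (a + j) (b + j) _ (fun r => (((D + (a + j) + (b + j) + 1 : ℕ) : ℂ) /
        ((a + j).factorial : ℂ)) * ((-1 : ℂ) ^ r * ((a + j).choose r : ℂ) *
      (((D + (a + j) + (b + j) - r).descFactorial (j - 1) : ℂ) *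
        (((a + j) + (b + j) - j - r).descFactorial ((a + j) - j) : ℂ))))]
    · rw [← Finset.mul_sum, aux_S_pos _ _ _ _ hj (by omega) (by omega), mul_zero]
    · intro r hk hl
      unfold auxJc auxMom
      rw [if_pos (by omega)]
      have h1 := aux_choose_cast (a + j) r hk
      have h2 := aux_desc_cast (D + (a + j) + (b + j) - r) (j - 1) (D + 2 + (a + j - r + b) - 1) (by omega)
      have h3 := aux_desc_cast ((a + j) + (b + j) - j - r) (a + j - j) (b + j - r) (by omega)
      rw [show D + 2 + (a + j) + (b + j) - 1 = D + (a + j) + (b + j) + 1 by omega,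
        show D + 2 + (a + j) + (b + j) - r - 2 = D + (a + j) + (b + j) - r by omega,
        ← h1, ← h2, show (a + j) - r + b = (a + j) + (b + j) - j - r by omega, ← h3]
      rw [show (a + j) + (b + j) - j - r = a + j - r + b by omega]
      have := aux_fne r
      have := aux_fne (a + j - r)
      have := aux_fne (b + j - r)
      have := aux_fne (D + 2 - 1)
      have := aux_fne (D + 2 + (a + j - r + b) - 1)
      have hc : ((a + j).choose r : ℂ) ≠ 0 := by exact_mod_cast (Nat.choose_pos hk).ne'
      field_simp
    · intro r hk hl
      rw [(Nat.descFactorial_eq_zero_iff_lt (n := (a + j) + (b + j) - j - r) (k := a + j - j)).2 (by omega)]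
      simp
  · refine Finset.sum_eq_zero fun r hr => ?_
    simp at hr
    unfold auxMom
    rw [if_neg (by omega), mul_zero]

theorem aux_A1 (D k l : ℕ) :
    ∑ r ∈ range (min k l + 1),
      auxJc (D + 2) k l r * auxMom (D + 2) (k - r + l) (l - r + k) =
    ((D + k + l + 1 : ℕ) : ℂ) * ((D + k).factorial : ℂ) * ((D + l).factorial : ℂ) /
        ((D.factorial : ℂ) * ((D + k + l + 1).factorial : ℂ)) := by
  rw [aux_extend k l _ (fun r => (((D + k + l + 1 : ℕ) : ℂ) /
        (k.factorial : ℂ)) * ((-1 : ℂ) ^ r * (k.choose r : ℂ) *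
      (((k + l - r).descFactorial k : ℂ) * (((D + l + k + 1 : ℕ) : ℂ) - r)⁻¹)))]
  · rw [← Finset.mul_sum, aux_S_zero, show D + l + k + 1 = D + k + l + 1 by ring]
    have := aux_fne k
    have := aux_fne D
    have := aux_fne (D + k + l + 1)
    field_simp
  · intro r hk hl
    unfold auxJc auxMom
    rw [if_pos (by omega)]
    have h1 := aux_choose_cast k r hk
    have h3 := aux_desc_cast (k + l - r) k (l - r) (by omega)
    rw [show D + 2 + k + l - 1 = D + k + l + 1 by omega,
        show D + 2 + k + l - r - 2 = D + k + l - r by omega,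
        show D + 2 + (k - r + l) - 1 = (D + k + l - r) + 1 by omega, Nat.factorial_succ,
        ← Nat.cast_sub (by omega : r ≤ D + l + k + 1),
        show D + l + k + 1 - r = D + k + l - r + 1 by omega,
        ← h1, show k - r + l = k + l - r by omega, ← h3]
    have := aux_fne r
    have := aux_fne (k - r)
    have := aux_fne (l - r)
    have := aux_fne (D + 2 - 1)
    have := aux_fne (D + k + l - r)
    have hc : (k.choose r : ℂ) ≠ 0 := by exact_mod_cast (Nat.choose_pos hk).ne'
    have hd : ((D + k + l - r + 1 : ℕ) : ℂ) ≠ 0 := by exact_mod_cast (D + k + l - r).succ_ne_zero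
    push_cast [-Nat.cast_sub] at *
    field_simp
  · intro r hk hl
    rw [(Nat.descFactorial_eq_zero_iff_lt (n := k + l - r) (k := k)).2 (by omega)]
    simp

/-- formal inner product of two Jacobi polynomials -/
noncomputable def auxIP (d k l k' l' : ℕ) : ℂ :=
  ∑ r ∈ range (min k l + 1), ∑ r' ∈ range (min k' l' + 1),
    auxJc d k l r * auxJc d k' l' r' * auxMom d (k - r + (l' - r')) (l - r + (k' - r'))

theorem aux_mom_symm (d a b : ℕ) : auxMom d a b = auxMom d b a := by
  unfold auxMom
  by_cases h : a = b
  · subst h; rfl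
  · rw [if_neg h, if_neg (Ne.symm h)]

theorem aux_ip_symm (d k l k' l' : ℕ) : auxIP d k l k' l' = auxIP d k' l' k l := by
  unfold auxIP
  rw [Finset.sum_comm]
  refine Finset.sum_congr rfl fun r _ => Finset.sum_congr rfl fun r' _ => ?_
  rw [aux_mom_symm, mul_comm (auxJc d k l r'), Nat.add_comm (l - r'), Nat.add_comm (k - r')]

theorem aux_ip_comm (d k l k' l' : ℕ) : auxIP d k l k' l' =
    ∑ r' ∈ range (min k' l' + 1), auxJc d k' l' r' * ∑ r ∈ range (min k l + 1),
      auxJc d k l r * auxMom d (k - r + (l' - r')) (l - r + (k' - r')) := by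
  unfold auxIP
  rw [Finset.sum_comm]
  refine Finset.sum_congr rfl fun r _ => ?_
  rw [Finset.mul_sum]
  refine Finset.sum_congr rfl fun r' _ => ?_
  ring

theorem aux_ip_le (D k l k' l' : ℕ) (hk : k' ≤ k) (hl : l' ≤ l) (hne : ¬ (k' = k ∧ l' = l)) :
    auxIP (D + 2) k l k' l' = 0 := by
  rw [aux_ip_comm]
  refine Finset.sum_eq_zero fun r' _ => ?_
  rw [aux_A0 D k l (k' - r') (l' - r') (by omega) (by omega) (by omega), mul_zero]

theorem aux_ip_ne (D k l k' l' : ℕ) (hne : ¬ (k' = k ∧ l' = l)) :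
    auxIP (D + 2) k l k' l' = 0 := by
  by_cases h1 : k' ≤ k ∧ l' ≤ l
  · exact aux_ip_le D k l k' l' h1.1 h1.2 hne
  by_cases h2 : k ≤ k' ∧ l ≤ l'
  · rw [aux_ip_symm]
    exact aux_ip_le D k' l' k l h2.1 h2.2 (by omega)
  unfold auxIP
  refine Finset.sum_eq_zero fun r hr => Finset.sum_eq_zero fun r' hr' => ?_
  simp at hr hr'
  unfold auxMom
  rw [if_neg (by omega), mul_zero]

theorem aux_ip_self (D k l : ℕ) : auxIP (D + 2) k l k l = jacobi (D + 2) k l 1 := by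
  rw [aux_ip_comm, Finset.sum_range_succ', Finset.sum_eq_zero]
  · rw [zero_add]
    simp only [Nat.sub_zero]
    rw [aux_A1, aux_jacobi_one]
    unfold auxJc
    rw [show D + 2 + k + l - 1 = D + k + l + 1 by omega,
      show D + 2 + k + l - 0 - 2 = D + k + l by omega, show D + 2 - 1 = D + 1 by omega,
      Nat.factorial_succ (D + k + l)]
    have := aux_fne k
    have := aux_fne l
    have := aux_fne D
    have := aux_fne (D + 1)
    have := aux_fne (D + k + l)
    have hd : ((D + k + l + 1 : ℕ) : ℂ) ≠ 0 := by exact_mod_cast (D + k + l).succ_ne_zero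
    simp only [pow_zero, Nat.factorial_zero, Nat.cast_one, Nat.sub_zero]
    rw [Nat.cast_mul]
    field_simp
  · intro r hr
    simp at hr
    rw [aux_A0 D k l (k - (r + 1)) (l - (r + 1)) (by omega) (by omega) (by omega), mul_zero]

theorem aux_jacobi_one_ne (D k l : ℕ) : jacobi (D + 2) k l 1 ≠ 0 := by
  rw [aux_jacobi_one]
  have hd : ((D + k + l + 1 : ℕ) : ℂ) ≠ 0 := by exact_mod_cast (D + k + l).succ_ne_zero
  have := aux_fne
  simp only [ne_eq, div_eq_zero_iff, mul_eq_zero, this, hd, or_self, not_false_eq_true]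

theorem aux_jc_conj (d k l r : ℕ) : (starRingEnd ℂ) (auxJc d k l r) = auxJc d k l r := by
  unfold auxJc
  simp

theorem aux_jacobi_one_conj (d k l : ℕ) :
    (starRingEnd ℂ) (jacobi d k l 1) = jacobi d k l 1 := by
  rw [aux_jacobi_eq]
  simp [aux_jc_conj]

theorem aux_mom_sum {d : ℕ} (X : Finset (Fin d → ℂ)) (T : Finset (ℕ × ℕ))
    (hdes : IsDesign d X T) (x : Fin d → ℂ) (hx : cInner x x = 1) (a b : ℕ) (hab : (a, b) ∈ T) :
    ∑ y ∈ X, cInner x y ^ a * (starRingEnd ℂ) (cInner x y) ^ b = (X.card : ℂ) * auxMom d a b := by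
  have hexp : ∀ y : Fin d → ℂ, cInner x y ^ a * (starRingEnd ℂ) (cInner x y) ^ b =
      ∑ α ∈ piAntidiag univ a, ∑ β ∈ piAntidiag univ b,
        ((Nat.multinomial univ α : ℂ) * ∏ i, (starRingEnd ℂ) (x i) ^ α i) *
        ((Nat.multinomial univ β : ℂ) * ∏ i, (x i) ^ β i) *
        ((∏ i, (y i) ^ (α i)) * ∏ i, ((starRingEnd ℂ) (y i)) ^ (β i)) := by
    intro y
    unfold cInner
    rw [map_sum, Finset.sum_pow_eq_sum_piAntidiag, Finset.sum_pow_eq_sum_piAntidiag,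
      Finset.sum_mul_sum]
    refine Finset.sum_congr rfl fun α _ => Finset.sum_congr rfl fun β _ => ?_
    simp only [map_mul, Complex.conj_conj, mul_pow, Finset.prod_mul_distrib]
    ring
  simp only [hexp]
  rw [Finset.sum_comm]
  have hstep : ∀ α ∈ piAntidiag (univ : Finset (Fin d)) a,
      ∑ y ∈ X, ∑ β ∈ piAntidiag univ b,
        ((Nat.multinomial univ α : ℂ) * ∏ i, (starRingEnd ℂ) (x i) ^ α i) *
        ((Nat.multinomial univ β : ℂ) * ∏ i, (x i) ^ β i) *
        ((∏ i, (y i) ^ (α i)) * ∏ i, ((starRingEnd ℂ) (y i)) ^ (β i)) =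
      (X.card : ℂ) * auxMom d a b *
        ((Nat.multinomial univ α : ℂ) * ∏ i, ((starRingEnd ℂ) (x i) * x i) ^ α i) := by
    intro α hα
    have hα' : ∑ i, α i = a := (mem_piAntidiag.1 hα).1
    rw [Finset.sum_comm]
    have h1 : ∀ β ∈ piAntidiag (univ : Finset (Fin d)) b, ∑ y ∈ X,
        ((Nat.multinomial univ α : ℂ) * ∏ i, (starRingEnd ℂ) (x i) ^ α i) *
        ((Nat.multinomial univ β : ℂ) * ∏ i, (x i) ^ β i) *
        ((∏ i, (y i) ^ (α i)) * ∏ i, ((starRingEnd ℂ) (y i)) ^ (β i)) =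
        ((Nat.multinomial univ α : ℂ) * ∏ i, (starRingEnd ℂ) (x i) ^ α i) *
        ((Nat.multinomial univ β : ℂ) * ∏ i, (x i) ^ β i) * ((X.card : ℂ) * monomialAvg d α β) := by
      intro β hβ
      rw [← Finset.mul_sum, hdes (a, b) hab α β hα' (mem_piAntidiag.1 hβ).1]
    rw [Finset.sum_congr rfl h1]
    by_cases hab' : a = b
    · subst hab'
      rw [Finset.sum_eq_single α]
      · unfold monomialAvg auxMom
        rw [if_pos rfl, if_pos rfl, hα']
        have h2 : (∏ i, ((α i).factorial : ℂ)) * (Nat.multinomial univ α : ℂ) = (a.factorial : ℂ) := by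
          rw [← hα']
          exact_mod_cast Nat.multinomial_spec univ α
        rw [← h2]
        simp only [mul_pow, Finset.prod_mul_distrib]
        ring
      · intro β _ hne
        unfold monomialAvg
        rw [if_neg (Ne.symm hne)]; simp
      · intro h; exact absurd hα h
    · unfold auxMom
      rw [if_neg hab']
      simp only [mul_zero, zero_mul]
      refine Finset.sum_eq_zero fun β hβ => ?_
      unfold monomialAvg
      rw [if_neg]
      · simp
      · rintro rfl
        exact hab' (hα'.symm.trans (mem_piAntidiag.1 hβ).1)
  rw [Finset.sum_congr rfl hstep, ← Finset.mul_sum, ← Finset.sum_pow_eq_sum_piAntidiag]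
  have : ∑ i, (starRingEnd ℂ) (x i) * x i = 1 := hx
  rw [this]; simp

theorem aux_orth {D : ℕ} (U : Finset (ℕ × ℕ)) (hU : IsLowerSet' U) (X : Finset (Fin (D + 2) → ℂ))
    (hdes : IsDesign (D + 2) X (convSet U U)) (x : Fin (D + 2) → ℂ) (hx : cInner x x = 1)
    (u v : ℕ × ℕ) (hu : u ∈ U) (hv : v ∈ U) :
    ∑ y ∈ X, jacobi (D + 2) u.1 u.2 (cInner x y) *
      (starRingEnd ℂ) (jacobi (D + 2) v.1 v.2 (cInner x y)) =
    if u = v then (X.card : ℂ) * jacobi (D + 2) u.1 u.2 1 else 0 := by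
  have key : ∑ y ∈ X, jacobi (D + 2) u.1 u.2 (cInner x y) *
      (starRingEnd ℂ) (jacobi (D + 2) v.1 v.2 (cInner x y)) =
      (X.card : ℂ) * auxIP (D + 2) u.1 u.2 v.1 v.2 := by
    have hexp : ∀ y, jacobi (D + 2) u.1 u.2 (cInner x y) *
      (starRingEnd ℂ) (jacobi (D + 2) v.1 v.2 (cInner x y)) =
        ∑ r ∈ range (min u.1 u.2 + 1), ∑ r' ∈ range (min v.1 v.2 + 1),
          auxJc (D + 2) u.1 u.2 r * auxJc (D + 2) v.1 v.2 r' *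
          (cInner x y ^ (u.1 - r + (v.2 - r')) *
            (starRingEnd ℂ) (cInner x y) ^ (u.2 - r + (v.1 - r'))) := by
      intro y
      rw [aux_jacobi_eq, aux_jacobi_eq, map_sum, Finset.sum_mul_sum]
      refine Finset.sum_congr rfl fun r _ => Finset.sum_congr rfl fun r' _ => ?_
      simp only [map_mul, map_pow, aux_jc_conj, Complex.conj_conj, pow_add]
      ring
    simp only [hexp]
    unfold auxIP
    rw [Finset.sum_comm, Finset.mul_sum]
    refine Finset.sum_congr rfl fun r _ => ?_
    rw [Finset.sum_comm, Finset.mul_sum]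
    refine Finset.sum_congr rfl fun r' _ => ?_
    rw [← Finset.mul_sum, aux_mom_sum X (convSet U U) hdes x hx]
    · ring
    · unfold convSet
      rw [Finset.mem_image]
      refine ⟨((u.1 - r, u.2 - r), (v.1 - r', v.2 - r')), ?_, ?_⟩
      · rw [Finset.mem_product]
        exact ⟨hU u hu _ (Nat.sub_le _ _) (Nat.sub_le _ _), hU v hv _ (Nat.sub_le _ _) (Nat.sub_le _ _)⟩
      · simp [Nat.add_comm]
  rw [key]
  split_ifs with h
  · subst h; rw [aux_ip_self]
  · rw [aux_ip_ne, mul_zero]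
    rintro ⟨h1, h2⟩
    exact h (Prod.ext h1.symm h2.symm)

theorem aux_one_notMem {d : ℕ} (X : Finset (Fin d → ℂ)) (hX : ∀ x ∈ X, cInner x x = 1) :
    (1 : ℂ) ∉ innerSet X := by
  intro h
  unfold innerSet at h
  simp only [Finset.mem_image, Finset.mem_filter, Finset.mem_product] at h
  obtain ⟨⟨x, y⟩, ⟨⟨hx, hy⟩, hne⟩, h1⟩ := h
  simp only at hx hy hne h1
  apply hne
  have hyx : cInner y x = 1 := by
    have : cInner y x = (starRingEnd ℂ) (cInner x y) := by
      unfold cInner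
      rw [map_sum]
      refine Finset.sum_congr rfl fun i _ => ?_
      simp [mul_comm]
    rw [this, h1]; simp
  have hsum : ∑ i, (starRingEnd ℂ) (x i - y i) * (x i - y i) = 0 := by
    have e : ∑ i, (starRingEnd ℂ) (x i - y i) * (x i - y i) =
        cInner x x - cInner x y - cInner y x + cInner y y := by
      unfold cInner
      rw [← Finset.sum_sub_distrib, ← Finset.sum_sub_distrib, ← Finset.sum_add_distrib]
      refine Finset.sum_congr rfl fun i _ => ?_
      rw [map_sub]; ring
    rw [e, hX x hx, hX y hy, h1, hyx]; ring
  have hsum' : ∑ i, Complex.normSq (x i - y i) = 0 := by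
    have : ((∑ i, Complex.normSq (x i - y i) : ℝ) : ℂ) = 0 := by
      rw [← hsum]; push_cast
      refine Finset.sum_congr rfl fun i _ => ?_
      rw [Complex.normSq_eq_conj_mul_self]
    exact_mod_cast this
  rw [Finset.sum_eq_zero_iff_of_nonneg (fun i _ => Complex.normSq_nonneg _)] at hsum'
  funext i
  exact sub_eq_zero.1 (Complex.normSq_eq_zero.1 (hsum' i (Finset.mem_univ i)))

/-- for a `U*U`-design of degree `s` with `|U| = s + 1`, every
inner product value is a root of `∑_{(k,l)∈U} g_{k,l}`. -/
theorem stmt_14 {d : ℕ} (hd : 2 ≤ d) (U : Finset (ℕ × ℕ)) (hU : IsLowerSet' U)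
    (X : Finset (Fin d → ℂ)) (hXne : X.Nonempty)
    (hXsphere : ∀ x ∈ X, cInner x x = 1)
    (hdesign : IsDesign d X (convSet U U))
    (s : ℕ) (hs : (innerSet X).card = s) (hUcard : U.card = s + 1) :
    ∀ α ∈ innerSet X, ∑ kl ∈ U, jacobi d kl.1 kl.2 α = 0 := by
  intro β hβ
  obtain ⟨D, rfl⟩ : ∃ D, d = D + 2 := ⟨d - 2, by omega⟩
  obtain ⟨x, hxX⟩ := hXne
  have hx := hXsphere x hxX
  have h1 := aux_one_notMem X hXsphere
  set A : Finset ℂ := insert 1 (innerSet X) with hA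
  have hAcard : A.card = s + 1 := by rw [hA, Finset.card_insert_of_notMem h1, hs]
  have hmaps : ∀ y ∈ X, cInner x y ∈ A := by
    intro y hy
    by_cases hxy : x = y
    · rw [← hxy, hx]; exact Finset.mem_insert_self _ _
    · refine Finset.mem_insert_of_mem ?_
      unfold innerSet
      rw [Finset.mem_image]
      exact ⟨(x, y), by simp [hxX, hy, hxy], rfl⟩
  let w : ℂ → ℂ := fun α => ((X.filter fun y => cInner x y = α).card : ℂ)
  have hfib : ∀ F : ℂ → ℂ, ∑ y ∈ X, F (cInner x y) = ∑ α ∈ A, w α * F α := by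
    intro F
    rw [← Finset.sum_fiberwise_of_maps_to hmaps]
    refine Finset.sum_congr rfl fun α _ => ?_
    rw [Finset.sum_congr rfl (g := fun _ => F α)]
    · simp [w]
    · intro y hy
      rw [(Finset.mem_filter.1 hy).2]
  have hXc : (X.card : ℂ) ≠ 0 := by
    exact_mod_cast (Finset.card_pos.2 ⟨x, hxX⟩).ne'
  let P : Matrix U A ℂ := Matrix.of fun u α => jacobi (D + 2) u.1.1 u.1.2 α.1
  let Q : Matrix A U ℂ := Matrix.of fun α v => w α.1 *
    (starRingEnd ℂ) (jacobi (D + 2) v.1.1 v.1.2 α.1) *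
      ((X.card : ℂ) * jacobi (D + 2) v.1.1 v.1.2 1)⁻¹
  have hPQ : P * Q = 1 := by
    ext u v
    rw [Matrix.mul_apply, Matrix.one_apply]
    have ho := aux_orth U hU X hdesign x hx u.1 v.1 u.2 v.2
    rw [hfib (fun t => jacobi (D + 2) u.1.1 u.1.2 t *
      (starRingEnd ℂ) (jacobi (D + 2) v.1.1 v.1.2 t))] at ho
    have e : ∑ α : A, P u α * Q α v = (∑ α ∈ A, w α * (jacobi (D + 2) u.1.1 u.1.2 α *
        (starRingEnd ℂ) (jacobi (D + 2) v.1.1 v.1.2 α))) *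
        ((X.card : ℂ) * jacobi (D + 2) v.1.1 v.1.2 1)⁻¹ := by
      rw [← Finset.sum_coe_sort A, Finset.sum_mul]
      refine Finset.sum_congr rfl fun α _ => ?_
      simp only [P, Q, Matrix.of_apply]
      ring
    rw [e, ho]
    by_cases huv : u = v
    · subst huv
      rw [if_pos rfl, if_pos rfl, mul_inv_cancel₀]
      exact mul_ne_zero hXc (aux_jacobi_one_ne _ _ _)
    · rw [if_neg huv, if_neg (fun h => huv (Subtype.ext h)), zero_mul]
  have hcard : Fintype.card U = Fintype.card A := by
    rw [Fintype.card_coe, Fintype.card_coe, hAcard, hUcard]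
  have hQP : Q * P = 1 :=
    (Matrix.mul_eq_one_comm_of_equiv (A := P) (B := Q) (Fintype.equivOfCardEq hcard)).1 hPQ
  have hrow : ∀ α : A, ∑ v : U, Q ⟨1, Finset.mem_insert_self _ _⟩ v * P v α =
      w 1 * (X.card : ℂ)⁻¹ * ∑ kl ∈ U, jacobi (D + 2) kl.1 kl.2 α.1 := by
    intro α
    rw [← Finset.sum_coe_sort U, Finset.mul_sum]
    refine Finset.sum_congr rfl fun v _ => ?_
    simp only [P, Q, Matrix.of_apply]
    rw [aux_jacobi_one_conj]
    have := aux_jacobi_one_ne D v.1.1 v.1.2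
    field_simp
  have hβA : β ∈ A := Finset.mem_insert_of_mem hβ
  have e1 := hrow ⟨β, hβA⟩
  rw [← Matrix.mul_apply, hQP, Matrix.one_apply, if_neg] at e1
  swap
  · intro h
    have : (1 : ℂ) = β := congrArg Subtype.val h
    exact h1 (this ▸ hβ)
  have hw : w 1 ≠ 0 := by
    have : 0 < (X.filter fun y => cInner x y = 1).card :=
      Finset.card_pos.2 ⟨x, Finset.mem_filter.2 ⟨hxX, hx⟩⟩
    simp only [w]
    exact_mod_cast this.ne'
  rcases mul_eq_zero.1 e1.symm with h | h
  · exact absurd h (mul_ne_zero hw (inv_ne_zero hXc))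
  · exact h
end

section
/- Let d ≥ 2, let 𝒰 be a lower set, and let X ⊆ Ω(d) be a complex spherical 𝒰*𝒰-design whose inner product set A(X) has cardinality s. Then (i) |𝒰| ≤ s+1, and (ii) if |𝒰| = s+1, then |X| = Σ_{(k,l)∈𝒰} m_{k,l} (X is a tight design with respect to 𝒰). -/
open Finset

/-- Coefficient of the complex Hermite expansion of `z ^ a * conj z ^ b`. -/
noncomputable def wk (a b : ℕ) (pq : ℕ × ℕ) : ℝ :=
  if pq.1 ≤ a ∧ pq.2 ≤ b ∧ a + pq.2 = b + pq.1 then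
    ((a.factorial : ℝ) * b.factorial) /
      ((a - pq.1).factorial * pq.1.factorial * pq.2.factorial) else 0

/-- Squared norm of the complex Hermite polynomial. -/
noncomputable def ww (pq : ℕ × ℕ) : ℝ := (pq.1.factorial : ℝ) * pq.2.factorial

lemma wick_core (a n a' : ℕ) :
    ∑ p ∈ range (a + 1), ww (p, p + n) * wk a (a + n) (p, p + n) * wk a' (a' + n) (p, p + n)
      = ((a + a' + n).factorial : ℝ) := by
  have hV := Nat.add_choose_eq (a + n) a' a
  rw [← Finset.Nat.sum_antidiagonal_swap,
    Finset.Nat.sum_antidiagonal_eq_sum_range_succ_mk] at hV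
  have hV' : (((a + n + a').choose a : ℕ) : ℝ) * (a.factorial * (a' + n).factorial)
      = ((a + a' + n).factorial : ℝ) := by
    have := Nat.add_choose_mul_factorial_mul_factorial a (a' + n)
    rw [← Nat.cast_mul, ← Nat.cast_mul, ← mul_assoc,
      show a + n + a' = a + (a' + n) by ring, show a + a' + n = a + (a' + n) by ring, ← this]
    rw [Nat.choose_symm_add]
  rw [← hV', hV, Nat.cast_sum, Finset.sum_mul]
  refine Finset.sum_congr rfl fun p hp => ?_
  have hpa : p ≤ a := by simpa [Nat.lt_succ_iff] using hp
  simp only [Prod.swap]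
  by_cases hpa' : p ≤ a'
  · have e1 : ((a + n).choose (a - p) : ℝ) =
        (a + n).factorial / ((a - p).factorial * (p + n).factorial) := by
      rw [Nat.cast_choose ℝ (by omega), show a + n - (a - p) = p + n by omega]
    have e2 : (a'.choose p : ℝ) = a'.factorial / (p.factorial * (a' - p).factorial) :=
      Nat.cast_choose ℝ hpa'
    rw [Nat.cast_mul, e1, e2, wk, wk, if_pos (by simp; omega), if_pos (by simp; omega), ww]
    have := Nat.factorial_ne_zero
    field_simp
  · rw [Nat.choose_eq_zero_of_lt (by omega : a' < p)]
    simp [wk, hpa']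

lemma wick_le (a n a' N : ℕ) (ha : a + n < N) :
    ((a + a' + n).factorial : ℝ) =
      ∑ pq ∈ range N ×ˢ range N, ww pq * wk a (a + n) pq * wk a' (a' + n) pq := by
  rw [Finset.sum_product, ← wick_core]
  rw [← Finset.sum_subset (s₁ := range (a + 1)) (s₂ := range N)]
  · refine Finset.sum_congr rfl fun p hp => ?_
    have hpa : p ≤ a := by simpa [Nat.lt_succ_iff] using hp
    rw [Finset.sum_eq_single (p + n)]
    · intro q _ hq
      rw [wk, if_neg (by simp; omega)]; ring
    · intro h; simp at h; omega
  · intro p hp; simp at hp ⊢; omega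
  · intro p _ hp
    refine Finset.sum_eq_zero fun q _ => ?_
    simp at hp
    rw [wk, if_neg (by simp; omega)]; ring

lemma wk_swap (a b : ℕ) (pq : ℕ × ℕ) : wk a b pq.swap = wk b a pq := by
  unfold wk
  by_cases h : pq.1 ≤ b ∧ pq.2 ≤ a ∧ b + pq.2 = a + pq.1
  · rw [if_pos (by simp; omega), if_pos h]
    simp only [Prod.fst_swap, Prod.snd_swap]
    rw [show a - pq.2 = b - pq.1 by omega]
    ring
  · rw [if_neg (by simp; omega), if_neg h]

lemma wick (a b a' b' N : ℕ) (ha : a < N) (hb : b < N) :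
    (if a + b' = b + a' then ((a + b').factorial : ℝ) else 0) =
      ∑ pq ∈ range N ×ˢ range N, ww pq * wk a b pq * wk a' b' pq := by
  split_ifs with h
  · rcases le_total a b with hab | hab
    · obtain ⟨n, rfl⟩ := Nat.exists_eq_add_of_le hab
      obtain rfl : b' = a' + n := by omega
      rw [← wick_le a n a' N hb, add_assoc]
    · obtain ⟨n, rfl⟩ := Nat.exists_eq_add_of_le hab
      obtain rfl : a' = b' + n := by omega
      rw [show b + n + b' = b + b' + n by ring, wick_le b n b' N ha]
      refine Finset.sum_bij' (fun pq _ => pq.swap) (fun pq _ => pq.swap) ?_ ?_ ?_ ?_ ?_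
      · intro x hx; simp at hx ⊢; omega
      · intro x hx; simp at hx ⊢; omega
      · simp
      · simp
      · intro x _
        rw [wk_swap, wk_swap]
        simp [ww, mul_comm]
  · symm
    refine Finset.sum_eq_zero fun pq _ => ?_
    unfold wk
    split_ifs <;> first | omega | simp

/-- multivariate version -/
lemma wick_multi {d : ℕ} (a b a' b' : Fin d → ℕ) (N : ℕ) (ha : ∀ i, a i < N)
    (hb : ∀ i, b i < N) :
    (if a + b' = b + a' then (∏ i, ((a i + b' i).factorial : ℝ)) else 0) =
      ∑ P ∈ Fintype.piFinset (fun _ : Fin d => range N ×ˢ range N),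
        (∏ i, ww (P i)) * (∏ i, wk (a i) (b i) (P i)) * (∏ i, wk (a' i) (b' i) (P i)) := by
  have h := Finset.prod_univ_sum (fun _ : Fin d => range N ×ˢ range N)
    (fun i pq => ww pq * wk (a i) (b i) pq * wk (a' i) (b' i) pq)
  simp only [Finset.prod_mul_distrib] at h
  rw [← h]
  rw [← Finset.prod_congr rfl fun i _ => wick (a i) (b i) (a' i) (b' i) N (ha i) (hb i)]
  split_ifs with hab
  · refine Finset.prod_congr rfl fun i _ => ?_
    exact (if_pos (congrFun hab i)).symm
  · obtain ⟨i, hi⟩ := Function.ne_iff.mp hab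
    exact (Finset.prod_eq_zero (Finset.mem_univ i) (if_neg hi)).symm

/-- the elements of `U` that are maximal on their diagonal -/
def tops (U : Finset (ℕ × ℕ)) : Finset (ℕ × ℕ) :=
  U.filter fun kl => (kl.1 + 1, kl.2 + 1) ∉ U

/-- pairs of exponents with bidegree in `T` -/
def idx (d : ℕ) (T : Finset (ℕ × ℕ)) : Finset ((Fin d → ℕ) × (Fin d → ℕ)) :=
  T.biUnion fun kl => finAntidiagonal d kl.1 ×ˢ finAntidiagonal d kl.2

/-- bidegree -/
def bideg {d : ℕ} (ab : (Fin d → ℕ) × (Fin d → ℕ)) : ℕ × ℕ := (∑ i, ab.1 i, ∑ i, ab.2 i)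

lemma mem_idx {d : ℕ} {T : Finset (ℕ × ℕ)} {ab : (Fin d → ℕ) × (Fin d → ℕ)} :
    ab ∈ idx d T ↔ bideg ab ∈ T := by
  simp only [idx, mem_biUnion, mem_product, mem_finAntidiagonal, bideg]
  constructor
  · rintro ⟨kl, h, h1, h2⟩
    rw [h1, h2]; exact h
  · intro h
    exact ⟨_, h, rfl, rfl⟩

/-- monomial function -/
noncomputable def mono {d : ℕ} (ab : (Fin d → ℕ) × (Fin d → ℕ)) (z : Fin d → ℂ) : ℂ :=
  (∏ i, z i ^ ab.1 i) * ∏ i, (starRingEnd ℂ) (z i) ^ ab.2 i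

lemma mono_mul {d : ℕ} (ab cd : (Fin d → ℕ) × (Fin d → ℕ)) (z : Fin d → ℂ) :
    mono ab z * mono cd z = mono (ab + cd) z := by
  simp only [mono, Prod.fst_add, Prod.snd_add, Pi.add_apply, pow_add, Finset.prod_mul_distrib]
  ring

lemma mono_conj {d : ℕ} (ab : (Fin d → ℕ) × (Fin d → ℕ)) (z : Fin d → ℂ) :
    (starRingEnd ℂ) (mono ab z) = mono ab.swap z := by
  simp [mono, mul_comm]

lemma tops_inj {U : Finset (ℕ × ℕ)} (hU : IsLowerSet' U) :
    ∀ x ∈ tops U, ∀ y ∈ tops U, x.1 + y.2 = x.2 + y.1 → x = y := by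
  intro x hx y hy h
  simp only [tops, mem_filter] at hx hy
  rcases lt_trichotomy x.1 y.1 with h1 | h1 | h1
  · exact absurd (hU y hy.1 (x.1 + 1, x.2 + 1) (by simp; omega) (by simp; omega)) hx.2
  · exact Prod.ext h1 (by omega)
  · exact absurd (hU x hx.1 (y.1 + 1, y.2 + 1) (by simp; omega) (by simp; omega)) hy.2

/-- localized coefficient -/
noncomputable def vv {d : ℕ} (kl : ℕ × ℕ) (P : Fin d → ℕ × ℕ)
    (ab : (Fin d → ℕ) × (Fin d → ℕ)) : ℝ :=
  if bideg ab = kl then ∏ i, wk (ab.1 i) (ab.2 i) (P i) else 0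

/-- weight -/
noncomputable def kap (d : ℕ) (kl : ℕ × ℕ) : ℝ :=
  ((d - 1).factorial : ℝ) / (d + (kl.1 + kl.2) - 1).factorial

lemma avg_expand {d : ℕ} (T : Finset (ℕ × ℕ))
    (hT : ∀ x ∈ T, ∀ y ∈ T, x.1 + y.2 = x.2 + y.1 → x = y)
    (ab cd : (Fin d → ℕ) × (Fin d → ℕ)) (h1 : ab ∈ idx d T) (h2 : cd ∈ idx d T)
    (N : ℕ) (hN1 : ∀ i, ab.1 i < N) (hN2 : ∀ i, ab.2 i < N) :
    monomialAvg d (ab.1 + cd.2) (ab.2 + cd.1) =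
      ((∑ kl ∈ T, ∑ P ∈ Fintype.piFinset (fun _ : Fin d => range N ×ˢ range N),
        (kap d kl * ∏ i, ww (P i)) * (vv kl P ab * vv kl P cd) : ℝ) : ℂ) := by
  rw [mem_idx] at h1 h2
  rw [Finset.sum_eq_single (bideg ab)]
  rotate_left
  · intro kl _ hkl
    refine Finset.sum_eq_zero fun P _ => ?_
    rw [vv, if_neg hkl.symm]; ring
  · intro h; exact absurd h1 h
  have hw := wick_multi ab.1 ab.2 cd.1 cd.2 N hN1 hN2
  by_cases h : bideg cd = bideg ab
  · have : ∀ P, (kap d (bideg ab) * ∏ i, ww (P i)) *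
        (vv (bideg ab) P ab * vv (bideg ab) P cd) = kap d (bideg ab) *
        ((∏ i, ww (P i)) * (∏ i, wk (ab.1 i) (ab.2 i) (P i)) *
          (∏ i, wk (cd.1 i) (cd.2 i) (P i))) := by
      intro P
      rw [vv, if_pos rfl, vv, if_pos h]; ring
    simp only [this]
    rw [← Finset.mul_sum, ← hw, monomialAvg]
    split_ifs with hab
    · have hs : ∑ i, (ab.1 + cd.2) i = (bideg ab).1 + (bideg ab).2 := by
        have := congrArg Prod.snd h
        simp only [bideg] at this ⊢
        simp [Finset.sum_add_distrib, this]
      rw [hs, kap]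
      push_cast
      simp only [Pi.add_apply]
      ring
    · simp
  · rw [monomialAvg, if_neg]
    · symm
      rw [Complex.ofReal_eq_zero]
      refine Finset.sum_eq_zero fun P _ => ?_
      rw [vv, vv, if_neg h]; ring
    · intro hab
      apply h
      symm
      apply hT _ h1 _ h2
      have := congrArg (fun f => ∑ i, f i) hab
      simpa [bideg, Finset.sum_add_distrib] using this

lemma wk_pos (a b : ℕ) : 0 < wk a b (a, b) := by
  rw [wk, if_pos (by simp; omega)]
  positivity

lemma vv_self {d : ℕ} (ab cd : (Fin d → ℕ) × (Fin d → ℕ)) (h : cd ≠ ab) :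
    vv (bideg ab) (fun i => (ab.1 i, ab.2 i)) cd = 0 := by
  rw [vv]
  split_ifs with hd
  · by_contra hne
    apply h
    replace hne := Finset.prod_ne_zero_iff.1 hne
    have hle : ∀ i, ab.1 i ≤ cd.1 i ∧ ab.2 i ≤ cd.2 i := by
      intro i
      have := hne i (mem_univ i)
      rw [wk] at this
      by_contra hc
      apply this
      rw [if_neg]
      simp only; tauto
    simp only [bideg, Prod.mk.injEq] at hd
    have e1 := (Finset.sum_eq_sum_iff_of_le fun i (_ : i ∈ univ) => (hle i).1).1 hd.1.symm
    have e2 := (Finset.sum_eq_sum_iff_of_le fun i (_ : i ∈ univ) => (hle i).2).1 hd.2.symm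
    refine Prod.ext (funext fun i => (e1 i (mem_univ i)).symm)
      (funext fun i => (e2 i (mem_univ i)).symm)
  · rfl

lemma key {d : ℕ} (U : Finset (ℕ × ℕ)) (hU : IsLowerSet' U)
    (X : Finset (Fin d → ℂ)) (hXne : X.Nonempty)
    (hdesign : IsDesign d X (convSet U U))
    (c : (Fin d → ℕ) × (Fin d → ℕ) → ℂ)
    (hc : ∀ z ∈ X, ∑ ab ∈ idx d (tops U), c ab * mono ab z = 0) :
    ∀ ab ∈ idx d (tops U), c ab = 0 := by
  set T := tops U with hTdef
  have hT := tops_inj hU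
  rw [← hTdef] at hT
  have hTU : ∀ x ∈ T, x ∈ U := fun x hx => (mem_filter.1 hx).1
  obtain ⟨N, hN⟩ : ∃ N, ∀ ab ∈ idx d T, (∀ i, ab.1 i < N) ∧ ∀ i, ab.2 i < N := by
    refine ⟨(T.sup fun kl => kl.1 + kl.2) + 1, fun ab hab => ?_⟩
    rw [mem_idx] at hab
    have h := Finset.le_sup (f := fun kl : ℕ × ℕ => kl.1 + kl.2) hab
    simp only [bideg] at h
    constructor <;> intro i
    · have := Finset.single_le_sum (f := ab.1) (fun _ _ => Nat.zero_le _) (mem_univ i)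
      omega
    · have := Finset.single_le_sum (f := ab.2) (fun _ _ => Nat.zero_le _) (mem_univ i)
      omega
  set PP := Fintype.piFinset (fun _ : Fin d => range N ×ˢ range N) with hPP
  have hdes : ∀ ab ∈ idx d T, ∀ cd ∈ idx d T, ∑ z ∈ X, mono ab z * mono cd.swap z =
      X.card * monomialAvg d (ab.1 + cd.2) (ab.2 + cd.1) := by
    intro ab hab cd hcd
    rw [mem_idx] at hab hcd
    have := hdesign ((bideg ab).1 + (bideg cd).2, (bideg cd).1 + (bideg ab).2)
      (mem_image.2 ⟨(bideg ab, bideg cd), mem_product.2 ⟨hTU _ hab, hTU _ hcd⟩, rfl⟩)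
      (ab.1 + cd.2) (ab.2 + cd.1) (by simp [bideg, Finset.sum_add_distrib])
      (by simp [bideg, Finset.sum_add_distrib, add_comm])
    rw [← this]
    refine Finset.sum_congr rfl fun z _ => ?_
    rw [mono_mul]; rfl
  have hz : (0 : ℂ) = ∑ z ∈ X, (∑ ab ∈ idx d T, c ab * mono ab z) *
      (starRingEnd ℂ) (∑ ab ∈ idx d T, c ab * mono ab z) := by
    symm
    refine Finset.sum_eq_zero fun z hz => ?_
    rw [hc z hz]; simp
  have hz2 : ∑ z ∈ X, (∑ ab ∈ idx d T, c ab * mono ab z) *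
      (starRingEnd ℂ) (∑ ab ∈ idx d T, c ab * mono ab z) =
      ∑ ab ∈ idx d T, ∑ cd ∈ idx d T, c ab * (starRingEnd ℂ) (c cd) *
        ∑ z ∈ X, mono ab z * mono cd.swap z := by
    simp only [map_sum, map_mul, mono_conj]
    simp only [Finset.sum_mul_sum]
    simp only [Finset.mul_sum]
    rw [Finset.sum_comm]
    refine Finset.sum_congr rfl fun ab _ => ?_
    rw [Finset.sum_comm]
    refine Finset.sum_congr rfl fun cd _ => ?_
    refine Finset.sum_congr rfl fun z _ => ?_
    ring
  have hz3 : ∑ ab ∈ idx d T, ∑ cd ∈ idx d T, c ab * (starRingEnd ℂ) (c cd) *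
        ∑ z ∈ X, mono ab z * mono cd.swap z =
      X.card * ∑ kl ∈ T, ∑ P ∈ PP, ((kap d kl * ∏ i, ww (P i) : ℝ) : ℂ) *
        ((∑ ab ∈ idx d T, c ab * (vv kl P ab : ℂ)) *
          (starRingEnd ℂ) (∑ ab ∈ idx d T, c ab * (vv kl P ab : ℂ))) := by
    have : ∀ ab ∈ idx d T, ∀ cd ∈ idx d T, c ab * (starRingEnd ℂ) (c cd) *
        ∑ z ∈ X, mono ab z * mono cd.swap z =
        ∑ kl ∈ T, ∑ P ∈ PP, X.card * (((kap d kl * ∏ i, ww (P i) : ℝ) : ℂ) *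
          ((c ab * (vv kl P ab : ℂ)) * (starRingEnd ℂ) (c cd * (vv kl P cd : ℂ)))) := by
      intro ab hab cd hcd
      rw [hdes ab hab cd hcd, avg_expand T hT ab cd hab hcd N (hN ab hab).1 (hN ab hab).2,
        Complex.ofReal_sum, Finset.mul_sum, Finset.mul_sum]
      refine Finset.sum_congr rfl fun kl _ => ?_
      rw [Complex.ofReal_sum, Finset.mul_sum, Finset.mul_sum]
      refine Finset.sum_congr rfl fun P _ => ?_
      rw [map_mul, Complex.conj_ofReal]
      push_cast
      ring
    rw [Finset.sum_congr rfl fun ab hab => Finset.sum_congr rfl fun cd hcd => this ab hab cd hcd]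
    simp only [map_sum]
    simp only [Finset.sum_mul_sum]
    simp only [Finset.mul_sum]
    rw [Finset.sum_congr rfl fun ab _ => Finset.sum_comm, Finset.sum_comm]
    refine Finset.sum_congr rfl fun kl _ => ?_
    rw [Finset.sum_congr rfl fun ab _ => Finset.sum_comm, Finset.sum_comm]
  have hz4 := hz3.symm.trans (hz2.symm.trans hz.symm)
  have hX0 : (X.card : ℂ) ≠ 0 := by
    exact_mod_cast (Finset.card_pos.2 hXne).ne'
  have hz5 := (mul_eq_zero.1 hz4).resolve_left hX0
  have hz6 : ∑ kl ∈ T, ∑ P ∈ PP, (kap d kl * ∏ i, ww (P i)) *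
      Complex.normSq (∑ ab ∈ idx d T, c ab * (vv kl P ab : ℂ)) = 0 := by
    simp only [Complex.mul_conj] at hz5
    exact_mod_cast hz5
  have hpos : ∀ kl (P : Fin d → ℕ × ℕ), 0 < kap d kl * ∏ i, ww (P i) := by
    intro kl P
    unfold kap ww
    positivity
  intro ab hab
  have h1 := (Finset.sum_eq_zero_iff_of_nonneg (fun kl _ => Finset.sum_nonneg fun P _ =>
    mul_nonneg (hpos kl P).le (Complex.normSq_nonneg _))).1 hz6 (bideg ab) (mem_idx.1 hab)
  have h2 := (Finset.sum_eq_zero_iff_of_nonneg (fun P _ =>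
    mul_nonneg (hpos _ P).le (Complex.normSq_nonneg _))).1 h1 (fun i => (ab.1 i, ab.2 i))
    (by simp only [hPP, Fintype.mem_piFinset, mem_product, mem_range]
        exact fun i => ⟨(hN ab hab).1 i, (hN ab hab).2 i⟩)
  have h3 := Complex.normSq_eq_zero.1 ((mul_eq_zero.1 h2).resolve_left (hpos _ _).ne')
  rw [Finset.sum_eq_single ab] at h3
  · refine (mul_eq_zero.1 h3).resolve_right ?_
    rw [Complex.ofReal_eq_zero, vv, if_pos rfl]
    exact Finset.prod_ne_zero_iff.2 fun i _ => (wk_pos _ _).ne'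
  · intro cd _ hne
    rw [vv_self ab cd hne]; simp
  · intro h; exact absurd hab h

/-- homogeneous functions of bidegree `(k,l)` -/
noncomputable def HH (d : ℕ) (kl : ℕ × ℕ) : Submodule ℂ ((Fin d → ℂ) → ℂ) :=
  Submodule.span ℂ (mono '' {ab | bideg ab = kl})

lemma mono_mem_HH {d : ℕ} (ab : (Fin d → ℕ) × (Fin d → ℕ)) (kl : ℕ × ℕ) (h : bideg ab = kl) :
    mono ab ∈ HH d kl := Submodule.subset_span ⟨ab, h, rfl⟩

lemma HH_mul {d : ℕ} {kl kl' : ℕ × ℕ} {f g : (Fin d → ℂ) → ℂ} (hf : f ∈ HH d kl)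
    (hg : g ∈ HH d kl') : f * g ∈ HH d (kl + kl') := by
  have h := Submodule.mul_mem_mul hf hg
  rw [HH, HH, Submodule.span_mul_span] at h
  refine Submodule.span_mono ?_ h
  rintro _ ⟨_, ⟨ab, hab, rfl⟩, _, ⟨cd, hcd, rfl⟩, rfl⟩
  refine ⟨ab + cd, ?_, ?_⟩
  · simp only [Set.mem_ofPred_eq] at *
    rw [← hab, ← hcd]
    simp [bideg, Finset.sum_add_distrib]
  · funext z
    exact (mono_mul ab cd z).symm

lemma HH_pow {d : ℕ} {kl : ℕ × ℕ} {f : (Fin d → ℂ) → ℂ} (hf : f ∈ HH d kl) (n : ℕ) :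
    f ^ n ∈ HH d (n • kl) := by
  induction n with
  | zero =>
    have : (f ^ 0 : (Fin d → ℂ) → ℂ) = mono 0 := by funext z; simp [mono]
    rw [this]
    exact mono_mem_HH _ _ (by simp [bideg])
  | succ n ih =>
    rw [pow_succ, succ_nsmul]
    exact HH_mul ih hf

lemma HH_inner {d : ℕ} (x : Fin d → ℂ) : (fun z => cInner x z) ∈ HH d (1, 0) := by
  have : (fun z => cInner x z) =
      ∑ i, (starRingEnd ℂ) (x i) • mono (Pi.single i 1, (0 : Fin d → ℕ)) := by
    funext z
    simp [cInner, mono, Pi.single_apply]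
  rw [this]
  refine Submodule.sum_mem _ fun i _ => Submodule.smul_mem _ _ (mono_mem_HH _ _ ?_)
  simp [bideg]

lemma HH_inner_conj {d : ℕ} (x : Fin d → ℂ) :
    (fun z => (starRingEnd ℂ) (cInner x z)) ∈ HH d (0, 1) := by
  have : (fun z => (starRingEnd ℂ) (cInner x z)) =
      ∑ i, x i • mono ((0 : Fin d → ℕ), Pi.single i 1) := by
    funext z
    simp [cInner, mono, Pi.single_apply]
  rw [this]
  refine Submodule.sum_mem _ fun i _ => Submodule.smul_mem _ _ (mono_mem_HH _ _ ?_)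
  simp [bideg]

lemma HH_self {d : ℕ} : (fun z : Fin d → ℂ => cInner z z) ∈ HH d (1, 1) := by
  have : (fun z : Fin d → ℂ => cInner z z) =
      ∑ i, mono ((Pi.single i 1 : Fin d → ℕ), Pi.single i 1) := by
    funext z
    simp [cInner, mono, Pi.single_apply, mul_comm]
  rw [this]
  refine Submodule.sum_mem _ fun i _ => (mono_mem_HH _ _ ?_)
  simp [bideg]

lemma HH_zonal {d : ℕ} (x : Fin d → ℂ) (k l j : ℕ) :
    (fun z => cInner x z ^ k * (starRingEnd ℂ) (cInner x z) ^ l * cInner z z ^ j)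
      ∈ HH d (k + j, l + j) := by
  have := HH_mul (HH_mul (HH_pow (HH_inner x) k) (HH_pow (HH_inner_conj x) l))
    (HH_pow (HH_self (d := d)) j)
  convert this using 1
  simp
  rfl

lemma exists_top {U : Finset (ℕ × ℕ)} (kl : ℕ × ℕ) (h : kl ∈ U) :
    ∃ j, (kl.1 + j, kl.2 + j) ∈ tops U := by
  have hex : ∃ j, (kl.1 + j, kl.2 + j) ∉ U := by
    refine ⟨(U.sup fun kl => kl.1) + 1, fun hm => ?_⟩
    have := Finset.le_sup (f := fun kl : ℕ × ℕ => kl.1) hm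
    simp only at this
    omega
  classical
  have h0 : Nat.find hex ≠ 0 := by
    intro h0
    have := Nat.find_spec hex
    rw [h0] at this
    exact this h
  obtain ⟨j, hj⟩ := Nat.exists_eq_succ_of_ne_zero h0
  refine ⟨j, mem_filter.2 ⟨?_, ?_⟩⟩
  · exact not_not.1 (Nat.find_min hex (by omega))
  · have := Nat.find_spec hex
    rw [hj] at this
    exact this

lemma exists_homog {d : ℕ} (U : Finset (ℕ × ℕ)) (c : ℕ × ℕ → ℂ) (x : Fin d → ℂ) :
    ∃ (e : (Fin d → ℕ) × (Fin d → ℕ) → ℂ) (j : ℕ × ℕ → ℕ), ∀ z,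
      ∑ kl ∈ U, c kl * (cInner x z ^ kl.1 * (starRingEnd ℂ) (cInner x z) ^ kl.2 *
        cInner z z ^ j kl) = ∑ ab ∈ idx d (tops U), e ab * mono ab z := by
  have : ∀ kl : ℕ × ℕ, ∃ j, kl ∈ U → (kl.1 + j, kl.2 + j) ∈ tops U := by
    intro kl
    by_cases h : kl ∈ U
    · obtain ⟨j, hj⟩ := exists_top kl h
      exact ⟨j, fun _ => hj⟩
    · exact ⟨0, fun h' => absurd h' h⟩
  choose j hj using this
  have hm : (∑ kl ∈ U, c kl • (fun z => cInner x z ^ kl.1 *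
      (starRingEnd ℂ) (cInner x z) ^ kl.2 * cInner z z ^ j kl)) ∈
      Submodule.span ℂ (mono '' (idx d (tops U) : Set ((Fin d → ℕ) × (Fin d → ℕ)))) := by
    refine Submodule.sum_mem _ fun kl hkl => Submodule.smul_mem _ _ ?_
    refine Submodule.span_mono ?_ (HH_zonal x kl.1 kl.2 (j kl))
    rintro _ ⟨ab, hab, rfl⟩
    refine ⟨ab, ?_, rfl⟩
    simp only [Set.mem_ofPred_eq] at hab
    rw [mem_coe, mem_idx, hab]
    exact hj kl hkl
  rw [Submodule.mem_span_image_finset_iff_exists_fun'] at hm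
  obtain ⟨e, he⟩ := hm
  refine ⟨e, j, fun z => ?_⟩
  have := congrFun he z
  simpa [Finset.sum_apply] using this.symm

lemma poly_zero (U : Finset (ℕ × ℕ)) (c : ℕ × ℕ → ℂ)
    (h : ∀ u : ℂ, ‖u‖ ≤ 1 → ∑ kl ∈ U, c kl * (u ^ kl.1 * (starRingEnd ℂ) u ^ kl.2) = 0) :
    ∀ kl ∈ U, c kl = 0 := by
  classical
  set N := U.sup fun kl => kl.2 with hN
  have hle : ∀ kl ∈ U, kl.2 ≤ N := fun kl hkl =>
    Finset.le_sup (f := fun kl : ℕ × ℕ => kl.2) hkl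
  set ex : ℕ × ℕ → (Fin 2 →₀ ℕ) := fun kl =>
    Finsupp.equivFunOnFinite.symm ![kl.1 + kl.2, kl.1 + (N - kl.2)] with hex
  set p : MvPolynomial (Fin 2) ℂ := ∑ kl ∈ U, MvPolynomial.monomial (ex kl) (c kl) with hp
  set S : Fin 2 → Set ℂ := ![(fun r : ℝ => (r : ℂ)) '' Set.Icc 0 1, Metric.sphere 0 1] with hS
  have hinf : ∀ i, (S i).Infinite := by
    intro i
    fin_cases i
    · simp only [hS]
      exact (Set.Icc_infinite one_pos).image (Complex.ofReal_injective.injOn)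
    · simp only [hS]
      refine Set.infinite_of_injOn_mapsTo (s := Set.Icc (0 : ℝ) 1)
        (f := fun r : ℝ => (⟨r, Real.sqrt (1 - r ^ 2)⟩ : ℂ)) ?_ ?_ (Set.Icc_infinite one_pos)
      · intro m _ n _ hmn
        exact congrArg Complex.re hmn
      · intro r hr
        have h1 : 0 ≤ 1 - r ^ 2 := by nlinarith [hr.1, hr.2]
        change _ ∈ Metric.sphere (0 : ℂ) 1
        rw [mem_sphere_zero_iff_norm, ← sq_eq_sq₀ (norm_nonneg _) zero_le_one,
          ← Complex.normSq_eq_norm_sq, Complex.normSq_mk, Real.mul_self_sqrt h1]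
        ring
  have hp0 : p = 0 := by
    refine MvPolynomial.funext_set S hinf fun v hv => ?_
    obtain ⟨r, hr, hr'⟩ : v 0 ∈ (fun r : ℝ => (r : ℂ)) '' Set.Icc 0 1 := hv 0 trivial
    have h1 : v 1 ∈ Metric.sphere (0 : ℂ) 1 := hv 1 trivial
    have h1n : ‖v 1‖ = 1 := by simpa using h1
    have h1c : v 1 * (starRingEnd ℂ) (v 1) = 1 := by
      rw [Complex.mul_conj, Complex.normSq_eq_norm_sq, h1n]; simp
    have h2 := h (v 0 * v 1) (by
      rw [norm_mul, h1n, ← hr', Complex.norm_real, Real.norm_of_nonneg hr.1, mul_one]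
      exact hr.2)
    have h0c : (starRingEnd ℂ) (v 0) = v 0 := by rw [← hr']; exact Complex.conj_ofReal r
    rw [map_zero, hp, map_sum]
    have : ∀ kl ∈ U, MvPolynomial.eval v (MvPolynomial.monomial (ex kl) (c kl)) =
        v 1 ^ N * (c kl * ((v 0 * v 1) ^ kl.1 * (starRingEnd ℂ) (v 0 * v 1) ^ kl.2)) := by
      intro kl hkl
      obtain ⟨m, hm⟩ := Nat.exists_eq_add_of_le (hle kl hkl)
      rw [MvPolynomial.eval_monomial, Finsupp.prod_fintype _ _ (by simp)]
      simp only [hex, Fin.prod_univ_two, Finsupp.equivFunOnFinite_symm_apply_apply,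
        Matrix.cons_val_zero, Matrix.cons_val_one]
      rw [map_mul, h0c, hm, Nat.add_sub_cancel_left]
      have : v 1 ^ kl.2 * (starRingEnd ℂ) (v 1) ^ kl.2 = 1 := by
        rw [← mul_pow, h1c, one_pow]
      simp only [pow_add, mul_pow]
      linear_combination (-c kl * v 0 ^ kl.1 * v 0 ^ kl.2 * v 1 ^ kl.1 * v 1 ^ m) * this
    rw [Finset.sum_congr rfl this, ← Finset.mul_sum, h2, mul_zero]
  intro kl hkl
  have hco := congrArg (MvPolynomial.coeff (ex kl)) hp0
  rw [hp, MvPolynomial.coeff_sum, Finset.sum_eq_single kl] at hco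
  · simpa using hco
  · intro kl' hkl' hne
    rw [MvPolynomial.coeff_monomial, if_neg]
    intro he
    apply hne
    have e0 := DFunLike.congr_fun he 0
    have e1 := DFunLike.congr_fun he 1
    simp only [hex, Finsupp.equivFunOnFinite_symm_apply_apply,
        Matrix.cons_val_zero, Matrix.cons_val_one] at e0 e1
    have := hle kl hkl
    have := hle kl' hkl'
    exact Prod.ext (by omega) (by omega)
  · intro hh; exact absurd hkl hh

lemma exists_perp {d : ℕ} (hd : 2 ≤ d) (x : Fin d → ℂ) :
    ∃ y : Fin d → ℂ, y ≠ 0 ∧ cInner x y = 0 := by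
  let L : (Fin d → ℂ) →ₗ[ℂ] ℂ :=
    { toFun := fun y => cInner x y
      map_add' := by intro a b; simp [cInner, mul_add, Finset.sum_add_distrib]
      map_smul' := by
        intro a b; simp only [cInner, Pi.smul_apply, smul_eq_mul, Finset.mul_sum, RingHom.id_apply]
        exact Finset.sum_congr rfl fun i _ => by ring }
  have hk : LinearMap.ker L ≠ ⊥ := by
    apply LinearMap.ker_ne_bot_of_finrank_lt
    simp; omega
  obtain ⟨y, hy, hy0⟩ := Submodule.exists_mem_ne_zero_of_ne_bot hk
  exact ⟨y, hy0, hy⟩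

lemma cInner_self {d : ℕ} (y : Fin d → ℂ) :
    cInner y y = ((∑ i, Complex.normSq (y i) : ℝ) : ℂ) := by
  rw [cInner, Complex.ofReal_sum]
  exact Finset.sum_congr rfl fun i _ => by rw [mul_comm, Complex.mul_conj]

lemma cInner_conj {d : ℕ} (x y : Fin d → ℂ) :
    (starRingEnd ℂ) (cInner x y) = cInner y x := by
  simp [cInner, mul_comm]

lemma coeff_zero {d : ℕ} (hd : 2 ≤ d) (U : Finset (ℕ × ℕ)) (c : ℕ × ℕ → ℂ) (x : Fin d → ℂ)
    (hx : cInner x x = 1) (j : ℕ × ℕ → ℕ)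
    (h : ∀ z, ∑ kl ∈ U, c kl * (cInner x z ^ kl.1 * (starRingEnd ℂ) (cInner x z) ^ kl.2 *
        cInner z z ^ j kl) = 0) : ∀ kl ∈ U, c kl = 0 := by
  obtain ⟨y, hy0, hxy⟩ := exists_perp hd x
  have hyx : cInner y x = 0 := by rw [← cInner_conj, hxy, map_zero]
  obtain ⟨i, hi⟩ := Function.ne_iff.mp hy0
  have hR : 0 < ∑ i, Complex.normSq (y i) :=
    Finset.sum_pos' (fun _ _ => Complex.normSq_nonneg _)
      ⟨i, mem_univ i, Complex.normSq_pos.2 hi⟩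
  set R := ∑ i, Complex.normSq (y i) with hRdef
  apply poly_zero
  intro u hu
  set v : ℝ := Real.sqrt ((1 - Complex.normSq u) / R) with hv
  have hu2 : Complex.normSq u ≤ 1 := by
    rw [Complex.normSq_eq_norm_sq]
    exact pow_le_one₀ (norm_nonneg _) hu
  have hv2 : v * v = (1 - Complex.normSq u) / R :=
    Real.mul_self_sqrt (div_nonneg (by linarith) hR.le)
  have hv3 : v * v * R = 1 - Complex.normSq u := by
    rw [hv2]; field_simp
  have hadd : ∀ a b c : Fin d → ℂ, ∀ s t : ℂ,
      cInner a (s • b + t • c) = s * cInner a b + t * cInner a c := by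
    intro a b c s t
    simp only [cInner, Pi.add_apply, Pi.smul_apply, smul_eq_mul, Finset.mul_sum,
      ← Finset.sum_add_distrib]
    exact Finset.sum_congr rfl fun i _ => by ring
  have e1 : cInner x (u • x + (v : ℂ) • y) = u := by rw [hadd, hx, hxy]; ring
  have e2 : cInner y (u • x + (v : ℂ) • y) = v * R := by
    rw [hadd, hyx, cInner_self y, ← hRdef]; ring
  have e3 : cInner (u • x + (v : ℂ) • y) (u • x + (v : ℂ) • y) = 1 := by
    rw [hadd, ← cInner_conj x, ← cInner_conj y, e1, e2, Complex.mul_conj, map_mul,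
      Complex.conj_ofReal, Complex.conj_ofReal, ← mul_assoc]
    norm_cast
    rw [hv3]; ring
  have := h (u • x + (v : ℂ) • y)
  simpa only [e1, e3, one_pow, mul_one] using this

lemma card_finAnti {d : ℕ} (hd : 2 ≤ d) (k : ℕ) :
    (finAntidiagonal d k).card = (d + k - 1).choose (d - 1) := by
  have h1 : (finAntidiagonal d k).card = Fintype.card (Sym (Fin d) k) := by
    rw [← Fintype.card_coe]
    refine Fintype.card_congr (Equiv.trans ?_ (Sym.equivNatSumOfFintype (Fin d) k).symm)
    exact Equiv.subtypeEquivRight fun f => mem_finAntidiagonal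
  rw [h1, Sym.card_sym_eq_choose, Fintype.card_fin]
  rw [← Nat.choose_symm (by omega : d - 1 ≤ d + k - 1)]
  congr 1; omega

lemma card_idx {d : ℕ} (hd : 2 ≤ d) (T : Finset (ℕ × ℕ)) :
    (idx d T).card =
      ∑ kl ∈ T, (d + kl.1 - 1).choose (d - 1) * (d + kl.2 - 1).choose (d - 1) := by
  rw [idx, Finset.card_biUnion]
  · refine Finset.sum_congr rfl fun kl _ => ?_
    rw [Finset.card_product, card_finAnti hd, card_finAnti hd]
  · intro x _ y _ hxy
    rw [Function.onFun, Finset.disjoint_left]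
    intro ab h1 h2
    simp only [mem_product, mem_finAntidiagonal] at h1 h2
    exact hxy (Prod.ext (h1.1.symm.trans h2.1) (h1.2.symm.trans h2.2))

lemma telescope {d : ℕ} (hd : 2 ≤ d) (U : Finset (ℕ × ℕ)) (hU : IsLowerSet' U) :
    ∑ kl ∈ tops U, (d + kl.1 - 1).choose (d - 1) * (d + kl.2 - 1).choose (d - 1) =
      ∑ kl ∈ U, mdim d kl.1 kl.2 := by
  set h : ℕ × ℕ → ℕ := fun kl => (d + kl.1 - 1).choose (d - 1) * (d + kl.2 - 1).choose (d - 1)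
    with hh
  set g : ℕ × ℕ → ℕ := fun kl => (d + kl.1 - 2).choose (d - 1) * (d + kl.2 - 2).choose (d - 1)
    with hg
  have h1 : ∑ kl ∈ U, h kl = ∑ kl ∈ U, mdim d kl.1 kl.2 + ∑ kl ∈ U, g kl := by
    rw [← Finset.sum_add_distrib]
    refine Finset.sum_congr rfl fun kl _ => ?_
    have : g kl ≤ h kl := Nat.mul_le_mul (Nat.choose_le_choose _ (by omega))
      (Nat.choose_le_choose _ (by omega))
    simp only [hh, hg, mdim] at *
    omega
  have h2 : ∑ kl ∈ U, h kl = ∑ kl ∈ tops U, h kl +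
      ∑ kl ∈ U with (kl.1 + 1, kl.2 + 1) ∈ U, h kl := by
    rw [← Finset.sum_filter_add_sum_filter_not U (fun kl => (kl.1 + 1, kl.2 + 1) ∈ U), add_comm]
    rfl
  have h3 : ∑ kl ∈ U with (kl.1 + 1, kl.2 + 1) ∈ U, h kl = ∑ kl ∈ U, g kl := by
    rw [← Finset.sum_filter_add_sum_filter_not U (fun kl => 0 < kl.1 ∧ 0 < kl.2) g]
    have hz : ∑ kl ∈ U with ¬ (0 < kl.1 ∧ 0 < kl.2), g kl = 0 := by
      refine Finset.sum_eq_zero fun kl hkl => ?_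
      have := (mem_filter.1 hkl).2
      by_cases h0 : kl.1 = 0
      · simp only [hg]
        rw [Nat.choose_eq_zero_of_lt (by omega : d + kl.1 - 2 < d - 1), zero_mul]
      · simp only [hg]
        rw [Nat.choose_eq_zero_of_lt (by omega : d + kl.2 - 2 < d - 1), mul_zero]
    rw [hz, add_zero]
    refine Finset.sum_bij' (fun kl _ => (kl.1 + 1, kl.2 + 1)) (fun kl _ => (kl.1 - 1, kl.2 - 1))
      ?_ ?_ ?_ ?_ ?_
    · intro kl hkl
      simp only [mem_filter] at hkl ⊢
      exact ⟨hkl.2, by omega, by omega⟩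
    · intro kl hkl
      simp only [mem_filter] at hkl ⊢
      refine ⟨hU kl hkl.1 _ (by simp) (by simp), ?_⟩
      rw [Nat.sub_add_cancel hkl.2.1, Nat.sub_add_cancel hkl.2.2]
      exact hkl.1
    · intro kl _; simp
    · intro kl hkl
      simp only [mem_filter] at hkl
      exact Prod.ext (by simp; omega) (by simp; omega)
    · intro kl _
      simp only [hh, hg]
      rw [show d + (kl.1 + 1) - 2 = d + kl.1 - 1 by omega,
        show d + (kl.2 + 1) - 2 = d + kl.2 - 1 by omega]
  change ∑ kl ∈ tops U, h kl = _
  linarith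

lemma eq_of_inner_one {d : ℕ} (x y : Fin d → ℂ) (hx : cInner x x = 1) (hy : cInner y y = 1)
    (hxy : cInner x y = 1) : x = y := by
  have hyx : cInner y x = 1 := by rw [← cInner_conj, hxy, map_one]
  have h : cInner (x - y) (x - y) = 0 := by
    have : cInner (x - y) (x - y) = cInner x x - cInner x y - cInner y x + cInner y y := by
      simp only [cInner, ← Finset.sum_add_distrib, ← Finset.sum_sub_distrib, Pi.sub_apply, map_sub]
      exact Finset.sum_congr rfl fun i _ => by ring
    rw [this, hx, hy, hxy, hyx]; ring
  rw [cInner_self, Complex.ofReal_eq_zero,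
    Finset.sum_eq_zero_iff_of_nonneg fun _ _ => Complex.normSq_nonneg _] at h
  funext i
  exact sub_eq_zero.1 (Complex.normSq_eq_zero.1 (h i (mem_univ i)))

/-- evaluation of zonal polynomials on a finite set of inner products -/
noncomputable def evalMap (U : Finset (ℕ × ℕ)) (B : Finset ℂ) : (U → ℂ) →ₗ[ℂ] (B → ℂ) where
  toFun c t := ∑ kl : U, c kl * ((t : ℂ) ^ kl.1.1 * (starRingEnd ℂ) (t : ℂ) ^ kl.1.2)
  map_add' a b := by
    funext t; simp [add_mul, Finset.sum_add_distrib]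
  map_smul' a b := by
    funext t; simp [Finset.mul_sum, mul_assoc]

lemma evalMap_apply (U : Finset (ℕ × ℕ)) (B : Finset ℂ) (c : U → ℂ) (t : B) :
    evalMap U B c t = ∑ kl ∈ U, Function.extend Subtype.val c 0 kl *
      ((t : ℂ) ^ kl.1 * (starRingEnd ℂ) (t : ℂ) ^ kl.2) := by
  rw [← Finset.sum_coe_sort U]
  change ∑ kl : U, _ = _
  refine Finset.sum_congr rfl fun kl _ => ?_
  rw [Subtype.val_injective.extend_apply]

lemma main_aux {d : ℕ} (hd : 2 ≤ d) (U : Finset (ℕ × ℕ)) (hU : IsLowerSet' U)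
    (X : Finset (Fin d → ℂ)) (hXne : X.Nonempty)
    (hXsphere : ∀ x ∈ X, cInner x x = 1)
    (hdesign : IsDesign d X (convSet U U)) (B : Finset ℂ) (h1B : (1 : ℂ) ∈ B)
    (hB : ∀ x ∈ X, ∀ y ∈ X, cInner x y ∈ B) :
    U.card ≤ B.card ∧ (U.card = B.card → X.card = ∑ kl ∈ U, mdim d kl.1 kl.2) := by
  classical
  have hkey := key U hU X hXne hdesign
  have hinj : Function.Injective (evalMap U B) := by
    rw [← LinearMap.ker_eq_bot, LinearMap.ker_eq_bot']
    intro c hc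
    obtain ⟨x, hx⟩ := hXne
    set c' := Function.extend Subtype.val c 0 with hc'
    obtain ⟨e, j, he⟩ := exists_homog U c' x
    have he0 : ∀ ab ∈ idx d (tops U), e ab = 0 := by
      refine hkey e fun z hz => ?_
      rw [← he z, hXsphere z hz]
      have := congrFun hc ⟨cInner x z, hB x hx z hz⟩
      rw [evalMap_apply] at this
      simp only [one_pow, mul_one]
      exact this
    have h0 := coeff_zero hd U c' x (hXsphere x hx) j fun z => by
      rw [he z]
      exact Finset.sum_eq_zero fun ab hab => by rw [he0 ab hab, zero_mul]
    funext kl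
    have := h0 kl kl.2
    rwa [hc', Subtype.val_injective.extend_apply] at this
  refine ⟨?_, fun hcard => ?_⟩
  · simpa using LinearMap.finrank_le_finrank_of_injective hinj
  have hsurj : Function.Surjective (evalMap U B) :=
    (LinearMap.injective_iff_surjective_of_finrank_eq_finrank (by simpa using hcard)).1 hinj
  obtain ⟨c, hc⟩ := hsurj (Pi.single ⟨1, h1B⟩ 1)
  let M : idx d (tops U) → (X → ℂ) := fun ab z => mono ab.1 z.1
  have hli : LinearIndependent ℂ M := by
    rw [Fintype.linearIndependent_iff]
    intro g hg ab
    have := hkey (Function.extend Subtype.val g 0) (fun z hz => by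
      rw [← Finset.sum_coe_sort]
      have := congrFun hg ⟨z, hz⟩
      rw [Finset.sum_apply] at this
      refine Eq.trans (Finset.sum_congr rfl fun ab _ => ?_) this
      rw [Subtype.val_injective.extend_apply]; rfl) ab ab.2
    rwa [Subtype.val_injective.extend_apply] at this
  have hspan : Submodule.span ℂ (Set.range M) = ⊤ := by
    rw [eq_top_iff, ← (Pi.basisFun ℂ X).span_eq, Submodule.span_le]
    rintro _ ⟨x, rfl⟩
    obtain ⟨e, j, he⟩ := exists_homog U (Function.extend Subtype.val c 0) x.1
    rw [SetLike.mem_coe, Submodule.mem_span_range_iff_exists_fun]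
    refine ⟨fun ab => e ab, ?_⟩
    funext z
    have h1 := he z.1
    rw [hXsphere z.1 z.2] at h1
    simp only [one_pow, mul_one] at h1
    rw [← evalMap_apply U B c ⟨cInner x.1 z.1, hB _ x.2 _ z.2⟩, hc, ← Finset.sum_coe_sort] at h1
    rw [Finset.sum_apply]
    refine Eq.trans h1.symm ?_
    rw [Pi.basisFun_apply, Pi.single_apply, Pi.single_apply]
    by_cases hzx : z = x
    · subst hzx
      simp [hXsphere z.1 z.2]
    · rw [if_neg, if_neg hzx]
      intro h
      have h' := congrArg Subtype.val h
      exact hzx (Subtype.ext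
        (eq_of_inner_one _ _ (hXsphere x.1 x.2) (hXsphere z.1 z.2) h').symm)
  have hfr := finrank_span_eq_card hli
  rw [hspan, finrank_top, Module.finrank_fintype_fun_eq_card, Fintype.card_coe,
    Fintype.card_coe, card_idx hd, telescope hd U hU] at hfr
  exact hfr

open scoped Classical

/-- for a `U*U`-design of degree `s`: (i) `|U| ≤ s + 1`, and
(ii) if `|U| = s + 1` then `X` is tight: `|X| = ∑_{(k,l)∈U} m_{k,l}`. -/
theorem stmt_15 {d : ℕ} (hd : 2 ≤ d) (U : Finset (ℕ × ℕ)) (hU : IsLowerSet' U)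
    (X : Finset (Fin d → ℂ)) (hXne : X.Nonempty)
    (hXsphere : ∀ x ∈ X, cInner x x = 1)
    (hdesign : IsDesign d X (convSet U U))
    (s : ℕ) (hs : (innerSet X).card = s) :
    U.card ≤ s + 1 ∧ (U.card = s + 1 → X.card = ∑ kl ∈ U, mdim d kl.1 kl.2) := by
  have h1 : (1 : ℂ) ∉ innerSet X := by
    intro h
    simp only [innerSet, mem_image, mem_filter, mem_product] at h
    obtain ⟨p, ⟨⟨hp1, hp2⟩, hne⟩, hp⟩ := h
    exact hne (eq_of_inner_one _ _ (hXsphere _ hp1) (hXsphere _ hp2) hp)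
  have hcard : (insert 1 (innerSet X)).card = s + 1 := by
    rw [Finset.card_insert_of_notMem h1, hs]
  rw [← hcard]
  refine main_aux hd U hU X hXne hXsphere hdesign _ (mem_insert_self _ _) ?_
  intro x hx y hy
  by_cases hxy : x = y
  · subst hxy
    rw [hXsphere x hx]
    exact mem_insert_self _ _
  · refine mem_insert_of_mem ?_
    simp only [innerSet, mem_image, mem_filter, mem_product]
    exact ⟨(x, y), ⟨⟨hx, hy⟩, hxy⟩, rfl⟩
end
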